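/- Let p > 3 be a prime with p ≡ 3 (mod 4), let K = ℚ(√−p) and let h = h(−p) be the class number of K (which is odd). Let a be a positive integer with gcd(a, p) = 1 and set Z_a := Σ_{j=1}^{p−1} j·p^{(j+1)a−1}. Then in 𝔽_p one has Tr(θ^{Z_a}) = (−1)^{(h+1)/2} · (−2a/p), where (·/p) denotes the Legendre symbol. -/

import Mathlib

/-- `Z_a = ∑_{j=1}^{p-1} j p^{(j+1)a-1}`, a positive integer representing
`ζ(𝔽_p, a) = (1 - p^{-a})^{-1}` modulo `k_p = (p^p-1)/(p-1)`. -/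
def ZetaRep (p a : ℕ) : ℕ := ∑ j ∈ Finset.Icc 1 (p - 1), j * p ^ ((j + 1) * a - 1)

/-- The product `∏_{j<p} (x+j)^j`. -/
def twistedProd {R : Type*} [CommRing R] (p : ℕ) (x : R) : R := ∏ j ∈ Finset.range p, (x + j) ^ j

theorem prod_range_add_natCast_eq {R : Type*} [CommRing R] (p : ℕ) [Fact p.Prime] [CharP R p]
    (x : R) : ∏ j ∈ Finset.range p, (x + j) = x ^ p - x := by
  have h1 : ∏ a : ZMod p, (Polynomial.X - Polynomial.C a) = Polynomial.X ^ p - Polynomial.X := by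
    have h2 := FiniteField.roots_X_pow_card_sub_X (ZMod p)
    rw [ZMod.card] at h2
    have h3 := Polynomial.prod_multiset_X_sub_C_of_monic_of_roots_card_eq
      (p := (Polynomial.X ^ p - Polynomial.X : Polynomial (ZMod p))) ?_ ?_
    · rw [h2] at h3
      exact h3
    · exact Polynomial.monic_X_pow_sub (by simpa using (Fact.out : p.Prime).one_lt)
    · rw [h2, FiniteField.X_pow_card_sub_X_natDegree_eq _ (Fact.out : p.Prime).one_lt]
      simp [ZMod.card]
  have h4 := congrArg (Polynomial.eval₂ (ZMod.castHom (dvd_refl p) R) x) h1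
  rw [Polynomial.eval₂_finsetProd] at h4
  simp only [Polynomial.eval₂_sub, Polynomial.eval₂_X, Polynomial.eval₂_C,
    Polynomial.eval₂_pow] at h4
  rw [← h4, ← Equiv.prod_comp (Equiv.neg (ZMod p))]
  refine Finset.prod_bij (fun j _ => (j : ZMod p)) (fun _ _ => Finset.mem_univ _) ?_ ?_ ?_
  · intro i hi j hj hij
    exact Nat.ModEq.eq_of_lt_of_lt ((ZMod.natCast_eq_natCast_iff _ _ _).1 hij)
      (Finset.mem_range.1 hi) (Finset.mem_range.1 hj)
  · intro a _
    exact ⟨a.val, Finset.mem_range.2 a.val_lt, ZMod.natCast_zmod_val a⟩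
  · intro j _
    simp

theorem twistedProd_add_one_mul {R : Type*} [CommRing R] (p : ℕ) [Fact p.Prime] [CharP R p]
    (x : R) : twistedProd p (x + 1) * (x ^ p - x) = twistedProd p x * x ^ p := by
  have h1 : ∏ j ∈ Finset.range p, (x + 1 + j) = x ^ p - x := by
    rw [prod_range_add_natCast_eq, add_pow_char]; ring
  rw [← h1, twistedProd, ← Finset.prod_mul_distrib, twistedProd]
  have h2 := Finset.prod_range_succ' (fun j : ℕ => (x + j) ^ j) p
  rw [Finset.prod_range_succ] at h2
  simp only [CharP.cast_eq_zero, add_zero, pow_zero, mul_one] at h2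
  rw [h2]
  refine Finset.prod_congr rfl fun j _ => ?_
  push_cast
  ring

theorem sum_range_sub_shift {R : Type*} [CommRing R] (p : ℕ) [Fact p.Prime] [CharP R p]
    (G : R → R) (x : R) :
    ∑ i ∈ Finset.range p, G (x - i + 1) = ∑ i ∈ Finset.range p, G (x - i) := by
  have h1 := Finset.sum_range_succ (fun i : ℕ => G (x - i + 1)) p
  rw [Finset.sum_range_succ'] at h1
  simp only [CharP.cast_eq_zero, Nat.cast_zero, sub_zero, Nat.cast_add, Nat.cast_one] at h1
  have := add_right_cancel h1
  rw [← this]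
  refine Finset.sum_congr rfl fun i _ => ?_
  congr 1; ring

/-- The functional `h ↦ ∑_i f(η-i) h(-(η-i)-b)`. -/
def charlierFunctional {R : Type*} [CommRing R] (p : ℕ) (η b : R) (h : R → R) : R :=
  ∑ i ∈ Finset.range p, twistedProd p (η - i) * h (-(η - i) - b)

section
variable {R : Type*} [CommRing R] (p : ℕ) [Fact p.Prime] [CharP R p] {η b : R}

theorem charlierFunctional_shift (hη : η ^ p = η + b) (h : R → R) :
    charlierFunctional p η b (fun y => y * h (y - 1)) = -b * charlierFunctional p η b h := by
  unfold charlierFunctional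
  have h1 := sum_range_sub_shift p (fun x => twistedProd p x * h (-x - b)) η
  rw [← h1, Finset.mul_sum]
  refine Finset.sum_congr rfl fun i _ => ?_
  have h2 := twistedProd_add_one_mul p (η - i)
  have h3 : (η - i) ^ p = η - i + b := by
    rw [sub_pow_char, hη]
    have : ((i : R)) ^ p = i := by
      have := congrArg (ZMod.castHom (dvd_refl p) R) (ZMod.pow_card (i : ZMod p))
      rwa [map_pow, map_natCast] at this
    rw [this]; ring
  rw [h3] at h2
  beta_reduce
  have h4 : -(η - i) - b - 1 = -(η - i + 1) - b := by ring
  rw [h4]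
  linear_combination (h (-(η - i + 1) - b)) * h2

theorem charlierFunctional_descPochhammer_mul (hη : η ^ p = η + b) (m : ℕ) (h : R → R) :
    charlierFunctional p η b (fun y => (descPochhammer R m).eval y * h y) =
      (-b) ^ m * charlierFunctional p η b (fun y => h (y + m)) := by
  induction m generalizing h with
  | zero => simp
  | succ m ih =>
    have h1 := charlierFunctional_shift p hη
      (fun z => (descPochhammer R m).eval z * h (z + 1))
    rw [ih] at h1
    simp only [descPochhammer_succ_left, Polynomial.eval_mul, Polynomial.eval_X,
      Polynomial.eval_comp, Polynomial.eval_sub, Polynomial.eval_one]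
    simp only [sub_add_cancel] at h1
    simp only [mul_assoc, h1, pow_succ']
    simp only [Nat.cast_add, Nat.cast_one, add_assoc, neg_mul]

theorem charlierFunctional_gram (hη : η ^ p = η + b) (m n : ℕ) :
    charlierFunctional p η b (fun y => (descPochhammer R m).eval y * (descPochhammer R n).eval y)
      = charlierFunctional p η b (fun _ => 1) * ((-b) ^ m *
        ∑ k ∈ Finset.range (n + 1),
          (m.choose k) * (k.factorial : R) * (n.choose k) * (-b) ^ (n - k)) := by
  rw [charlierFunctional_descPochhammer_mul p hη]
  have h1 : ∀ y : R, (descPochhammer R n).eval (y + m) = ∑ k ∈ Finset.range (n + 1),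
      ((m.choose k) * (k.factorial : R) * (n.choose k)) * (descPochhammer R (n - k)).eval y := by
    intro y
    have h0 : ∀ (k : ℕ) (z : R), (descPochhammer ℤ k).smeval z = (descPochhammer R k).eval z := by
      intro k z
      rw [← Polynomial.aeval_eq_smeval, ← descPochhammer_map (Int.castRingHom R),
        Polynomial.eval_map]
      rfl
    have := Ring.descPochhammer_smeval_add (r := (m : R)) (s := y) n (Commute.all _ _)
    simp only [h0, descPochhammer_eval_eq_descFactorial] at this
    rw [add_comm, this, Finset.Nat.sum_antidiagonal_eq_sum_range_succ_mk]
    refine Finset.sum_congr rfl fun k _ => ?_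
    rw [Nat.descFactorial_eq_factorial_mul_choose]
    push_cast
    ring
  have h2 : ∀ k, charlierFunctional p η b (fun y => (descPochhammer R k).eval y) =
      (-b) ^ k * charlierFunctional p η b (fun _ => 1) := by
    intro k
    simpa using charlierFunctional_descPochhammer_mul p hη k (fun _ => 1)
  simp only [h1]
  have h3 : charlierFunctional p η b (fun y => ∑ k ∈ Finset.range (n + 1),
      ((m.choose k) * (k.factorial : R) * (n.choose k)) * (descPochhammer R (n - k)).eval y) =
      ∑ k ∈ Finset.range (n + 1), ((m.choose k) * (k.factorial : R) * (n.choose k)) *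
        charlierFunctional p η b (fun y => (descPochhammer R (n - k)).eval y) := by
    simp only [charlierFunctional, Finset.mul_sum]
    rw [Finset.sum_comm]
    refine Finset.sum_congr rfl fun k _ => Finset.sum_congr rfl fun i _ => by ring
  rw [h3]
  simp only [h2, Finset.mul_sum]
  refine Finset.sum_congr rfl fun k _ => by ring
end

/-- Evaluation of the Gram determinant of `charlierFunctional` in two ways. -/
theorem charlierFunctional_one_pow {F : Type*} [Field F] (p : ℕ) [Fact p.Prime] [CharP F p]
    (hp : Odd p) {η b : F} (hb : b ≠ 0) (hη : η ^ p = η + b) :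
    charlierFunctional p η b (fun _ => 1) ^ p =
      (-1) ^ ((p - 1) / 2) * ((p - 1).superFactorial : F) := by
  have hp0 : 0 < p := (Fact.out : p.Prime).pos
  set T := charlierFunctional p η b (fun _ => 1) with hT
  let y : Fin p → F := fun i => -(η - (i : ℕ)) - b
  let V : Matrix (Fin p) (Fin p) F := Matrix.of fun i j => (descPochhammer F j).eval (y i)
  let D : Matrix (Fin p) (Fin p) F := Matrix.diagonal fun i => twistedProd p (η - (i : ℕ))
  let C : Matrix (Fin p) (Fin p) F := Matrix.of fun m k => ((m : ℕ).choose k : F)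
  let B : Matrix (Fin p) (Fin p) F := Matrix.diagonal fun i => (-b) ^ (i : ℕ)
  let E : Matrix (Fin p) (Fin p) F :=
    Matrix.diagonal fun i => ((i : ℕ).factorial : F) * ((-b) ^ (i : ℕ))⁻¹
  have hb' : -b ≠ 0 := neg_ne_zero.2 hb
  have hG1 : ∀ m n : Fin p, (V.transpose * D * V) m n = charlierFunctional p η b
      (fun y => (descPochhammer F m).eval y * (descPochhammer F n).eval y) := by
    intro m n
    rw [Matrix.mul_assoc, Matrix.mul_apply, charlierFunctional, ← Fin.sum_univ_eq_sum_range (fun i =>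
      twistedProd p (η - i) * ((descPochhammer F m).eval (-(η - i) - b) *
        (descPochhammer F n).eval (-(η - i) - b)))]
    refine Finset.sum_congr rfl fun i _ => ?_
    simp only [D, V, y, Matrix.diagonal_mul, Matrix.transpose_apply, Matrix.of_apply]
    ring
  have hG2 : V.transpose * D * V = T • (B * C * E * C.transpose * B) := by
    ext m n
    rw [hG1, charlierFunctional_gram p hη, Matrix.smul_apply, smul_eq_mul]
    congr 1
    simp only [B, E, Matrix.mul_diagonal]
    rw [Matrix.mul_apply]
    simp only [Matrix.mul_diagonal, Matrix.diagonal_mul, Matrix.transpose_apply, C,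
      Matrix.of_apply]
    rw [Finset.mul_sum, Finset.sum_mul, Fin.sum_univ_eq_sum_range (fun k =>
      (-b) ^ (m : ℕ) * (((m : ℕ).choose k : ℕ) : F) * (((k.factorial : ℕ) : F) * ((-b) ^ k)⁻¹) *
        (((n : ℕ).choose k : ℕ) : F) * (-b) ^ (n : ℕ)) p]
    rw [← Finset.sum_subset (Finset.range_mono (Nat.succ_le_of_lt n.2))]
    · refine Finset.sum_congr rfl fun k hk => ?_
      have hk' : k ≤ n := Nat.lt_succ_iff.1 (Finset.mem_range.1 hk)
      have : (-b) ^ (n : ℕ) = (-b) ^ ((n : ℕ) - k) * (-b) ^ k := by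
        rw [← pow_add, Nat.sub_add_cancel hk']
      rw [this]
      field_simp
    · intro k _ hk
      rw [Nat.choose_eq_zero_of_lt (n := (n : ℕ)) (by simpa using hk)]
      simp
  have hfact : ∏ i ∈ Finset.range p, (i.factorial : F) = ((p - 1).superFactorial : F) := by
    rw [← Nat.prod_range_succ_factorial, Nat.sub_add_cancel hp0]
    push_cast
    rfl
  have hfact0 : ((p - 1).superFactorial : F) ≠ 0 := by
    rw [← hfact, Finset.prod_ne_zero_iff]
    intro i hi h
    rw [CharP.cast_eq_zero_iff F p, (Fact.out : p.Prime).dvd_factorial] at h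
    exact absurd (Finset.mem_range.1 hi) (not_lt.2 h)
  have hV : V.det = ((p - 1).superFactorial : F) := by
    rw [← Matrix.det_eval_matrixOfPolynomials_eq_det_vandermonde y
      (fun j => descPochhammer F j) (fun i => descPochhammer_natDegree F i)
      (fun i => monic_descPochhammer F i)]
    have hy : y = fun i : Fin p => ((i : ℕ) : F) - (η + b) := by
      funext i; simp only [y]; ring
    rw [hy, Matrix.det_vandermonde_sub]
    obtain ⟨q, rfl⟩ : ∃ q, p = q + 1 := ⟨p - 1, (Nat.sub_add_cancel hp0).symm⟩
    exact Matrix.det_vandermonde_id_eq_superFactorial q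
  have hC : C.det = 1 := by
    rw [Matrix.det_of_isLowerTriangular]
    · simp [C]
    · intro i j hij
      simp only [C, Matrix.of_apply]
      rw [Nat.choose_eq_zero_of_lt (by simpa using hij), Nat.cast_zero]
  have hsub : ∀ x : F, ∏ i ∈ Finset.range p, (x - i) = x ^ p - x := by
    intro x
    have h1 := prod_range_add_natCast_eq p (-x)
    have h2 : ∀ i : ℕ, (x - i : F) = -1 * (-x + i) := fun i => by ring
    simp only [h2]
    rw [Finset.prod_mul_distrib, h1, Finset.prod_const, Finset.card_range, hp.neg_one_pow,
      hp.neg_pow]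
    ring
  have hD : D.det = ∏ j ∈ Finset.range p, b ^ j := by
    rw [Matrix.det_diagonal, Fin.prod_univ_eq_prod_range (fun i => twistedProd p (η - i)) p]
    unfold twistedProd
    rw [Finset.prod_comm]
    refine Finset.prod_congr rfl fun j _ => ?_
    rw [Finset.prod_pow]
    have h1 : ∀ i : ℕ, (η - i + j : F) = (η + j) - i := fun i => by ring
    simp only [h1]
    have h2 : (j : F) ^ p = j := by
      have := congrArg (ZMod.castHom (dvd_refl p) F) (ZMod.pow_card (j : ZMod p))
      rwa [map_pow, map_natCast] at this
    rw [hsub, add_pow_char, hη, h2]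
    congr 1; ring
  have hdet := congrArg Matrix.det hG2
  rw [Matrix.det_smul, Fintype.card_fin] at hdet
  simp only [Matrix.det_mul, Matrix.det_transpose, hV, hC, hD] at hdet
  have hB : B.det = ∏ j ∈ Finset.range p, (-b) ^ j := by
    rw [Matrix.det_diagonal, Fin.prod_univ_eq_prod_range (fun i => (-b) ^ i) p]
  have hE : E.det = ((p - 1).superFactorial : F) * (∏ j ∈ Finset.range p, (-b) ^ j)⁻¹ := by
    rw [Matrix.det_diagonal, Fin.prod_univ_eq_prod_range
      (fun i => (i.factorial : F) * ((-b) ^ i)⁻¹) p, Finset.prod_mul_distrib, hfact,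
      Finset.prod_inv_distrib]
  have hbb : ∏ j ∈ Finset.range p, (-b) ^ j =
      (-1) ^ ((p - 1) / 2) * ∏ j ∈ Finset.range p, b ^ j := by
    rw [Finset.prod_pow_eq_pow_sum, Finset.prod_pow_eq_pow_sum, neg_pow, Finset.sum_range_id]
    congr 1
    obtain ⟨k, hk⟩ := hp
    have h1 : p * (p - 1) / 2 = p * k := by
      rw [hk, Nat.add_sub_cancel, show (2 * k + 1) * (2 * k) = (2 * k + 1) * k * 2 by ring,
        Nat.mul_div_cancel _ two_pos]
    have h2 : (p - 1) / 2 = k := by omega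
    rw [h1, h2, pow_mul, Odd.neg_one_pow ⟨k, hk⟩]
  have hb0 : ∏ j ∈ Finset.range p, b ^ j ≠ 0 :=
    Finset.prod_ne_zero_iff.2 fun j _ => pow_ne_zero _ hb
  rw [hB, hE, hbb] at hdet
  have hs : ((-1 : F) ^ ((p - 1) / 2)) * (-1) ^ ((p - 1) / 2) = 1 := by
    rw [← mul_pow]; simp
  have hs0 : ((-1 : F) ^ ((p - 1) / 2)) ≠ 0 := by simp
  generalize ((-1 : F) ^ ((p - 1) / 2)) = s at *
  generalize ((p - 1).superFactorial : F) = W at *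
  generalize ∏ j ∈ Finset.range p, b ^ j = P at *
  field_simp at hdet
  linear_combination (-s) * hdet + (-T ^ p) * hs

theorem sum_range_eq_sum_zmod {R M : Type*} [CommRing R] [AddCommMonoid M] (p : ℕ) [Fact p.Prime]
    [Algebra (ZMod p) R] (G : R → M) :
    ∑ i ∈ Finset.range p, G i = ∑ c : ZMod p, G (algebraMap (ZMod p) R c) := by
  refine Finset.sum_bij (fun j _ => (j : ZMod p)) (fun _ _ => Finset.mem_univ _) ?_ ?_ ?_
  · intro i hi j hj hij
    exact Nat.ModEq.eq_of_lt_of_lt ((ZMod.natCast_eq_natCast_iff _ _ _).1 hij)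
      (Finset.mem_range.1 hi) (Finset.mem_range.1 hj)
  · intro a _
    exact ⟨a.val, Finset.mem_range.2 a.val_lt, ZMod.natCast_zmod_val a⟩
  · intro j _
    simp

theorem natCast_pow_prime {R : Type*} [CommRing R] (p : ℕ) [Fact p.Prime] [CharP R p] (n : ℕ) :
    (n : R) ^ p = n := by
  rw [← frobenius_def, map_natCast]

theorem pow_prime_pow_of_artinSchreier {R : Type*} [CommRing R] (p : ℕ) [Fact p.Prime] [CharP R p]
    {x : R} (hx : x ^ p = x + 1) (i : ℕ) : x ^ p ^ i = x + i := by
  induction i with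
  | zero => simp
  | succ i ih =>
    rw [pow_succ, pow_mul, ih, add_pow_char, hx, natCast_pow_prime]
    push_cast
    ring

theorem pow_zetaRep {F : Type*} [Field F] (p : ℕ) [Fact p.Prime] [CharP F p] {a : ℕ} (ha : 1 ≤ a)
    (ha0 : (a : F) ≠ 0) {x : F} (hx : x ^ p = x + 1) :
    x ^ ZetaRep p a =
      (a : F) ^ (∑ j ∈ Finset.range p, j) * twistedProd p ((x + a - 1) * (a : F)⁻¹) := by
  rw [ZetaRep, ← Finset.prod_pow_eq_pow_sum, twistedProd, ← Finset.prod_pow_eq_pow_sum,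
    ← Finset.prod_mul_distrib]
  refine Finset.prod_subset_one_on_sdiff (fun j hj => ?_) (fun j hj => ?_) (fun j _ => ?_)
  · have := (Fact.out : p.Prime).pos
    rw [Finset.mem_Icc] at hj
    rw [Finset.mem_range]
    omega
  · have : j = 0 := by
      by_contra h
      apply (Finset.mem_sdiff.1 hj).2
      have := Finset.mem_range.1 (Finset.mem_sdiff.1 hj).1
      rw [Finset.mem_Icc]
      omega
    simp [this]
  · rw [mul_comm j, pow_mul, pow_prime_pow_of_artinSchreier p hx, ← mul_pow,
      Nat.cast_sub (by nlinarith)]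
    congr 1
    push_cast
    field_simp
    ring

theorem natCast_pow_sum_range {p : ℕ} [Fact p.Prime] (hp : Odd p) (a : ℕ) :
    (a : ZMod p) ^ (∑ j ∈ Finset.range p, j) = (legendreSym p a : ZMod p) := by
  rw [legendreSym.eq_pow, Finset.sum_range_id]
  obtain ⟨k, hk⟩ := hp
  have h1 : p * (p - 1) / 2 = p * k := by
    rw [hk, Nat.add_sub_cancel, show (2 * k + 1) * (2 * k) = (2 * k + 1) * k * 2 by ring,
      Nat.mul_div_cancel _ two_pos]
  have h2 : p / 2 = k := by omega
  rw [h1, h2, pow_mul, ZMod.pow_card]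
  simp

theorem trace_pow_zetaRep (p : ℕ) [Fact p.Prime] (hp : Odd p) (F : Type*) [Field F] [Fintype F]
    [Algebra (ZMod p) F] (hcard : Fintype.card F = p ^ p) {θ : F} (hθ : θ ^ p = θ + 1)
    {a : ℕ} (ha : 1 ≤ a) (ha0 : (a : ZMod p) ≠ 0) :
    Algebra.trace (ZMod p) F (θ ^ ZetaRep p a) = (legendreSym p a : ZMod p) *
      ((-1) ^ ((p - 1) / 2) * ((p - 1).superFactorial : ZMod p)) := by
  have : CharP F p := charP_of_injective_algebraMap (algebraMap (ZMod p) F).injective p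
  have haF : (a : F) ≠ 0 := by
    rw [← map_natCast (algebraMap (ZMod p) F)]
    exact (map_ne_zero _).2 ha0
  have hb : (a : F)⁻¹ ≠ 0 := inv_ne_zero haF
  set η : F := (θ + a - 1) * (a : F)⁻¹ with hη
  have hηp : η ^ p = η + (a : F)⁻¹ := by
    have h1 : (a : F) ^ p = a := natCast_pow_prime p a
    rw [hη, mul_pow, sub_pow_char, add_pow_char, hθ, inv_pow, h1, one_pow]
    ring
  have hfr : Module.finrank (ZMod p) F = p := by
    have h1 := Module.card_eq_pow_finrank (K := ZMod p) (V := F)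
    rw [hcard, ZMod.card] at h1
    exact (Nat.pow_right_injective (Fact.out : p.Prime).two_le h1).symm
  have htr : algebraMap (ZMod p) F (Algebra.trace (ZMod p) F (θ ^ ZetaRep p a)) =
      algebraMap (ZMod p) F (legendreSym p a : ZMod p) *
        charlierFunctional p η (a : F)⁻¹ fun _ => 1 := by
    rw [FiniteField.algebraMap_trace_eq_sum_pow, hfr, Nat.card_eq_fintype_card, ZMod.card,
      ← natCast_pow_sum_range hp, map_pow, map_natCast, charlierFunctional, Finset.mul_sum]
    have h1 : ∀ i : ℕ, (θ ^ ZetaRep p a) ^ p ^ i = (a : F) ^ (∑ j ∈ Finset.range p, j) *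
        twistedProd p (η + (i : F) * (a : F)⁻¹) := by
      intro i
      rw [← pow_mul, mul_comm, pow_mul, pow_prime_pow_of_artinSchreier p hθ,
        pow_zetaRep p ha haF (x := θ + i)]
      · rw [hη]; congr 2; ring
      · rw [add_pow_char, hθ, natCast_pow_prime]; ring
    simp only [h1, mul_one]
    rw [← Finset.mul_sum, ← Finset.mul_sum]
    congr 1
    rw [sum_range_eq_sum_zmod p (fun x : F => twistedProd p (η + x * (a : F)⁻¹)),
      sum_range_eq_sum_zmod p (fun x : F => twistedProd p (η - x)),
      ← Equiv.sum_comp (Equiv.mulRight₀ (-(a : ZMod p)) (neg_ne_zero.2 ha0))]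
    refine Finset.sum_congr rfl fun c _ => ?_
    congr 1
    simp
    field_simp
    ring
  have hT := charlierFunctional_one_pow p hp hb hηp
  have hl : (legendreSym p a : ZMod p) ≠ 0 := by
    rw [← natCast_pow_sum_range hp]
    exact pow_ne_zero _ ha0
  set t := Algebra.trace (ZMod p) F (θ ^ ZetaRep p a) with ht
  have hT2 : charlierFunctional p η (a : F)⁻¹ (fun _ => 1) =
      algebraMap (ZMod p) F ((legendreSym p a : ZMod p)⁻¹ * t) := by
    rw [map_mul, htr, ← mul_assoc, ← map_mul, inv_mul_cancel₀ hl, map_one, one_mul]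
  rw [hT2, ← map_pow, ZMod.pow_card] at hT
  have h3 : (legendreSym p a : ZMod p)⁻¹ * t =
      (-1) ^ ((p - 1) / 2) * ((p - 1).superFactorial : ZMod p) := by
    apply (algebraMap (ZMod p) F).injective
    rw [hT]
    simp
  rw [← h3, ← mul_assoc, mul_inv_cancel₀ hl, one_mul]

theorem factorial_mul_factorial_sub {p : ℕ} [Fact p.Prime] {n : ℕ} (hn : n < p) :
    (n.factorial : ZMod p) * ((p - 1 - n).factorial : ZMod p) = (-1) ^ (n + 1) := by
  induction n with
  | zero => simp
  | succ n ih =>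
    have h1 := ih (by omega)
    have h2 : p - 1 - n = (p - 1 - (n + 1)) + 1 := by omega
    rw [h2, Nat.factorial_succ] at h1
    have h3 : ((p - 1 - (n + 1) + 1 : ℕ) : ZMod p) = -(n + 1) := by
      rw [eq_neg_iff_add_eq_zero]
      have : ((p - 1 - (n + 1) + 1 + (n + 1) : ℕ) : ZMod p) = 0 := by
        rw [show p - 1 - (n + 1) + 1 + (n + 1) = p by omega]; simp
      exact_mod_cast this
    rw [Nat.cast_mul, h3] at h1
    rw [Nat.factorial_succ, pow_succ, ← h1]
    push_cast
    ring

theorem neg_one_pow_mul_superFactorial {p : ℕ} [Fact p.Prime] (hp4 : p % 4 = 3) :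
    (-1) ^ ((p - 1) / 2) * ((p - 1).superFactorial : ZMod p) =
      (((p - 1) / 2).factorial : ZMod p) * (legendreSym p (-2) : ZMod p) := by
  obtain ⟨M, hM⟩ : ∃ M, p = 2 * M + 1 := ⟨(p - 1) / 2, by omega⟩
  have hM2 : (p - 1) / 2 = M := by omega
  have hMo : Odd M := by rw [Nat.odd_iff]; omega
  have hpo : Odd p := ⟨M, hM⟩
  have hsf : ((p - 1).superFactorial : ZMod p) =
      M.factorial * ∏ n ∈ Finset.range M, (-1 : ZMod p) ^ (n + 1) := by
    rw [← Nat.prod_range_succ_factorial, Nat.sub_add_cancel (by omega),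
      show Finset.range p = Finset.range ((M + 1) + M) by congr 1; omega,
      Finset.prod_range_add, Finset.prod_range_succ]
    push_cast
    rw [mul_comm (∏ x ∈ Finset.range M, ((x.factorial : ℕ) : ZMod p)), mul_assoc,
      ← Finset.prod_range_reflect (fun x => (((M + 1 + x).factorial : ℕ) : ZMod p)),
      ← Finset.prod_mul_distrib]
    congr 1
    refine Finset.prod_congr rfl fun n hn => ?_
    rw [← factorial_mul_factorial_sub (n := n) (by have := Finset.mem_range.1 hn; omega)]
    congr 3
    have := Finset.mem_range.1 hn
    omega
  rw [hsf, hM2, mul_left_comm]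
  congr 1
  rw [hMo.neg_one_pow, Finset.prod_pow_eq_pow_sum, Finset.sum_add_distrib, Finset.sum_range_id]
  simp only [Finset.sum_const, Finset.card_range, smul_eq_mul, mul_one]
  have hp2 : p ≠ 2 := by omega
  rw [show (-2 : ℤ) = (-1) * 2 by norm_num, legendreSym.mul, legendreSym.at_neg_one hp2,
    legendreSym.at_two hp2, ZMod.χ₄_nat_three_mod_four hp4, ZMod.χ₈_nat_eq_if_mod_eight]
  obtain ⟨k, rfl⟩ := hMo
  rw [show (2 * k + 1) * (2 * k + 1 - 1) / 2 = (2 * k + 1) * k by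
    rw [Nat.add_sub_cancel, show (2 * k + 1) * (2 * k) = (2 * k + 1) * k * 2 by ring,
      Nat.mul_div_cancel _ two_pos], pow_add, pow_mul]
  rw [Odd.neg_one_pow ⟨k, rfl⟩]
  rcases Nat.even_or_odd k with hk | hk
  · have : p % 8 = 3 := by obtain ⟨r, rfl⟩ := hk; omega
    simp [hk.neg_one_pow, this]
    omega
  · have : p % 8 = 7 := by obtain ⟨r, rfl⟩ := hk; omega
    simp [hk.neg_one_pow, this]
    omega

theorem trace_pow_zetaRep_eq_factorial (p : ℕ) [Fact p.Prime] (hp4 : p % 4 = 3) (F : Type*)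
    [Field F] [Fintype F] [Algebra (ZMod p) F] (hcard : Fintype.card F = p ^ p) {θ : F}
    (hθ : θ ^ p = θ + 1) {a : ℕ} (ha : 1 ≤ a) (hap : Nat.gcd a p = 1) :
    Algebra.trace (ZMod p) F (θ ^ ZetaRep p a) =
      (((p - 1) / 2).factorial : ZMod p) * ((legendreSym p (-2 * a) : ℤ) : ZMod p) := by
  have ha0 : (a : ZMod p) ≠ 0 := by
    rw [Ne, ZMod.natCast_eq_zero_iff]
    intro h
    have := Nat.dvd_gcd h dvd_rfl
    rw [hap] at this
    exact (Fact.out : p.Prime).one_lt.ne' (Nat.dvd_one.1 this)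
  rw [trace_pow_zetaRep p (Nat.odd_iff.2 (by omega)) F hcard hθ ha ha0,
    neg_one_pow_mul_superFactorial hp4, legendreSym.mul]
  push_cast
  ring

theorem exists_card_sub_of_sq_eq_one {ι : Type*} (s : Finset ι) (f : ι → ℤ)
    (hf : ∀ i ∈ s, f i = 1 ∨ f i = -1) :
    ∃ N : ℕ, ∑ i ∈ s, f i = s.card - 2 * N ∧ ∏ i ∈ s, f i = (-1) ^ N := by
  classical
  induction s using Finset.induction_on with
  | empty => exact ⟨0, by simp⟩
  | insert i s hi ih =>
    obtain ⟨N, h1, h2⟩ := ih fun j hj => hf j (Finset.mem_insert_of_mem hj)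
    rw [Finset.sum_insert hi, Finset.prod_insert hi, Finset.card_insert_of_notMem hi, h1, h2]
    rcases hf i (Finset.mem_insert_self i s) with h | h
    · exact ⟨N, by rw [h]; push_cast; ring, by rw [h, one_mul]⟩
    · exact ⟨N + 1, by rw [h]; push_cast; ring, by rw [h, pow_succ]; ring⟩

theorem legendreSym_sub_of_three_mod_four {p : ℕ} [Fact p.Prime] (hp4 : p % 4 = 3) (k : ℤ) :
    legendreSym p (p - k) = -legendreSym p k := by
  rw [legendreSym.mod p (p - k), show ((p : ℤ) - k) % p = (-1 * k) % p by
    rw [sub_eq_add_neg, Int.add_emod_left, neg_one_mul], ← legendreSym.mod, legendreSym.mul,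
    legendreSym.at_neg_one (by omega), ZMod.χ₄_nat_three_mod_four hp4, neg_one_mul]

/-- The half-sum of the Legendre symbol in terms of its first moment. -/
theorem sum_half_legendreSym {p : ℕ} [Fact p.Prime] (hp4 : p % 4 = 3) :
    (legendreSym p 2 - 2) * ∑ k ∈ Finset.range p, (k : ℤ) * legendreSym p k =
      p * ∑ k ∈ Finset.range ((p - 1) / 2), legendreSym p (k + 1) := by
  obtain ⟨M, hM⟩ : ∃ M, p = 2 * M + 1 := ⟨(p - 1) / 2, by omega⟩
  rw [show (p - 1) / 2 = M by omega]
  have hpM : (p : ℤ) = 2 * M + 1 := by exact_mod_cast hM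
  have hg : ∀ g : ℤ → ℤ, ∑ k ∈ Finset.range p, g k =
      g 0 + ∑ k ∈ Finset.range M, (g (k + 1) + g (p - (k + 1))) := by
    intro g
    rw [show Finset.range p = Finset.range (M + M + 1) by congr 1; omega,
      Finset.sum_range_succ', Finset.sum_range_add, Finset.sum_add_distrib, add_comm]
    simp only [Nat.cast_zero, Nat.cast_add, Nat.cast_one]
    congr 2
    rw [← Finset.sum_range_reflect]
    refine Finset.sum_congr rfl fun k hk => ?_
    have := Finset.mem_range.1 hk
    congr 1
    rw [show M - 1 - k = M - (1 + k) by omega, Nat.cast_sub (by omega), hpM]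
    push_cast
    ring
  have hg2 : ∀ g : ℤ → ℤ, ∑ k ∈ Finset.range p, g k =
      g 0 + ∑ k ∈ Finset.range M, (g (2 * (k + 1)) + g (p - 2 * (k + 1))) := by
    intro g
    have hs : ∀ n : ℕ, ∑ k ∈ Finset.range (2 * n), g (k + 1) =
        ∑ k ∈ Finset.range n, (g (2 * k + 1) + g (2 * (k + 1))) := by
      intro n
      induction n with
      | zero => simp
      | succ n ih =>
        rw [show 2 * (n + 1) = 2 * n + 1 + 1 by ring, Finset.sum_range_succ, Finset.sum_range_succ,
          ih, Finset.sum_range_succ]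
        push_cast
        ring_nf
    rw [show Finset.range p = Finset.range (2 * M + 1) by rw [hM],
      Finset.sum_range_succ', add_comm]
    simp only [Nat.cast_zero, Nat.cast_add, Nat.cast_one]
    congr 1
    rw [hs, Finset.sum_add_distrib, Finset.sum_add_distrib, add_comm]
    congr 1
    rw [← Finset.sum_range_reflect]
    refine Finset.sum_congr rfl fun k hk => ?_
    have := Finset.mem_range.1 hk
    congr 1
    rw [show M - 1 - k = M - (1 + k) by omega, Nat.cast_sub (by omega), hpM]
    push_cast
    ring
  have h1 := hg fun k => k * legendreSym p k
  have h2 := hg2 fun k => k * legendreSym p k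
  have e2 : legendreSym p 2 * legendreSym p 2 = 1 := by
    rw [← sq]
    apply legendreSym.sq_one
    intro h
    have h0 : ((2 : ℕ) : ZMod p) = 0 := by exact_mod_cast h
    rw [ZMod.natCast_eq_zero_iff] at h0
    have := Nat.le_of_dvd two_pos h0
    omega
  simp only [legendreSym_sub_of_three_mod_four hp4, legendreSym.mul, zero_mul, zero_add] at h1 h2
  set S := ∑ k ∈ Finset.range p, (k : ℤ) * legendreSym p k
  have h1' : S = 2 * (∑ k ∈ Finset.range M, ((k : ℤ) + 1) * legendreSym p (k + 1)) -
      p * ∑ k ∈ Finset.range M, legendreSym p (k + 1) := by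
    rw [h1, Finset.mul_sum, Finset.mul_sum, ← Finset.sum_sub_distrib]
    exact Finset.sum_congr rfl fun k _ => by ring
  have h2' : S = legendreSym p 2 * (4 * (∑ k ∈ Finset.range M, ((k : ℤ) + 1) *
      legendreSym p (k + 1)) - p * ∑ k ∈ Finset.range M, legendreSym p (k + 1)) := by
    rw [h2, Finset.mul_sum, Finset.mul_sum, ← Finset.sum_sub_distrib, Finset.mul_sum]
    exact Finset.sum_congr rfl fun k _ => by ring
  generalize ∑ k ∈ Finset.range M, ((k : ℤ) + 1) * legendreSym p (k + 1) = B at *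
  generalize ∑ k ∈ Finset.range M, legendreSym p ((k : ℤ) + 1) = A at *
  linear_combination (-2) * h1' + legendreSym p 2 * h2' + (4 * B - p * A) * e2

theorem factorial_half_eq_of_mul_eq_neg_sum {p : ℕ} [Fact p.Prime] (hp4 : p % 4 = 3) {h : ℕ}
    (hS : (p : ℤ) * h = -∑ k ∈ Finset.range p, (k : ℤ) * legendreSym p k) :
    (((p - 1) / 2).factorial : ZMod p) = (-1) ^ ((h + 1) / 2) := by
  have hp0 : (p : ℤ) ≠ 0 := by exact_mod_cast (Fact.out : p.Prime).ne_zero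
  have hA := sum_half_legendreSym hp4
  have hMo : Odd ((p - 1) / 2) := by rw [Nat.odd_iff]; omega
  set M := (p - 1) / 2 with hM
  have hA' : (h : ℤ) * (2 - legendreSym p 2) = ∑ k ∈ Finset.range M, legendreSym p (k + 1) := by
    apply mul_left_cancel₀ hp0
    linear_combination (2 - legendreSym p 2) * hS + hA
  have hk0 : ∀ k ∈ Finset.range M, (((k : ℤ) + 1 : ℤ) : ZMod p) ≠ 0 := by
    intro k hk h0
    have h1 : ((k + 1 : ℕ) : ZMod p) = 0 := by exact_mod_cast h0
    rw [ZMod.natCast_eq_zero_iff] at h1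
    have := Nat.le_of_dvd (Nat.succ_pos _) h1
    have := Finset.mem_range.1 hk
    omega
  obtain ⟨N, hN1, hN2⟩ := exists_card_sub_of_sq_eq_one (Finset.range M)
    (fun k => legendreSym p (k + 1)) fun k hk => legendreSym.eq_one_or_neg_one p (hk0 k hk)
  have hprod : legendreSym p M.factorial = (-1) ^ N := by
    rw [← hN2, ← Finset.prod_range_add_one_eq_factorial]
    have := map_prod (legendreSym.hom p) (fun k : ℕ => (k : ℤ) + 1) (Finset.range M)
    push_cast
    exact this
  have hsq : (M.factorial : ZMod p) * (M.factorial : ZMod p) = 1 := by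
    have h1 := factorial_mul_factorial_sub (p := p) (n := M) (by omega)
    rwa [show p - 1 - M = M by omega, Even.neg_one_pow hMo.add_one] at h1
  have hfac : (M.factorial : ZMod p) = (-1) ^ N := by
    have h1 := legendreSym.eq_pow p M.factorial
    rw [hprod, show p / 2 = M by omega] at h1
    obtain ⟨r, hr⟩ := hMo
    have hpow : ∀ x : ZMod p, x * x = 1 → x ^ M = x := by
      intro x hx
      rw [hr, pow_succ, pow_mul, sq, hx, one_pow, one_mul]
    push_cast at h1
    rw [hpow _ hsq] at h1
    exact h1.symm
  rw [hfac, neg_one_pow_eq_pow_mod_two, neg_one_pow_eq_pow_mod_two (n := (h + 1) / 2)]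
  congr 1
  rw [hN1, legendreSym.at_two (by omega), ZMod.χ₈_nat_eq_if_mod_eight, Finset.card_range] at hA'
  split_ifs at hA' with h1 h2 <;> omega

theorem eval_pow_X_mul_derivative {R : Type*} [CommRing R] (n : ℕ) (Q : Polynomial R) :
    Polynomial.eval 1 ((((LinearMap.mulLeft R (Polynomial.X : Polynomial R)) ∘ₗ
      Polynomial.derivative) ^ n) ((Polynomial.X - 1) ^ n * Q)) = (n.factorial : R) * Q.eval 1 := by
  induction n generalizing Q with
  | zero => simp
  | succ n ih =>
    have h1 : ((LinearMap.mulLeft R (Polynomial.X : Polynomial R)) ∘ₗ Polynomial.derivative)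
        ((Polynomial.X - 1) ^ (n + 1) * Q) = (Polynomial.X - 1) ^ n *
          (Polynomial.X * (Polynomial.C ((n : R) + 1) * Q +
            (Polynomial.X - 1) * Polynomial.derivative Q)) := by
      simp [Polynomial.derivative_pow]
      ring
    rw [pow_succ, Module.End.mul_apply, h1, ih, Nat.factorial_succ]
    simp
    ring

theorem pow_X_mul_derivative_X_pow {R : Type*} [CommRing R] (n k : ℕ) (c : R) :
    (((LinearMap.mulLeft R (Polynomial.X : Polynomial R)) ∘ₗ Polynomial.derivative) ^ n)
      (Polynomial.C c * Polynomial.X ^ k) =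
        Polynomial.C (c * (k : R) ^ n) * Polynomial.X ^ k := by
  induction n with
  | zero => simp
  | succ n ih =>
    rw [pow_succ', Module.End.mul_apply, ih]
    rw [LinearMap.comp_apply, LinearMap.mulLeft_apply, Polynomial.derivative_C_mul_X_pow]
    rcases k with _ | k
    · simp
    · rw [Nat.add_sub_cancel, mul_left_comm, ← pow_succ', pow_succ _ n, mul_assoc]

theorem sum_range_pow_card_sub_one {p : ℕ} [Fact p.Prime] :
    ∑ k ∈ Finset.range p, (k : ZMod p) ^ (p - 1) = -1 := by
  have hp := (Fact.out : p.Prime).two_le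
  have h1 : ∀ k ∈ Finset.range (p - 1), ((k + 1 : ℕ) : ZMod p) ^ (p - 1) = 1 := by
    intro k hk
    apply ZMod.pow_card_sub_one_eq_one
    rw [Ne, ZMod.natCast_eq_zero_iff]
    intro h
    have := Nat.le_of_dvd (Nat.succ_pos _) h
    have := Finset.mem_range.1 hk
    omega
  rw [show Finset.range p = Finset.range (p - 1 + 1) by congr 1; omega, Finset.sum_range_succ',
    Finset.sum_congr rfl h1]
  simp [Nat.cast_sub (show 1 ≤ p by omega), show p - 1 ≠ 0 by omega]

theorem eq_neg_one_of_gaussSum_eq_mul_prod {p : ℕ} [Fact p.Prime] (hp4 : p % 4 = 3) {μ : ℂ}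
    (hμ : IsPrimitiveRoot μ p) {δ : ℤ}
    (h : ∑ k ∈ Finset.range p, (legendreSym p k : ℂ) * μ ^ k =
      δ * ∏ k ∈ Finset.range (p / 2), (μ ^ ((p / 2 + 1) * (k + 1)) - μ ^ (p / 2 * (k + 1)))) :
    (δ : ZMod p) = -1 := by
  have hMo : Odd (p / 2) := by rw [Nat.odd_iff]; omega
  have hpM : p = 2 * (p / 2) + 1 := by omega
  set M := p / 2 with hM
  have hp0 : 0 < p := (Fact.out : p.Prime).pos
  let f : Polynomial ℤ := ∑ k ∈ Finset.range p, Polynomial.C (legendreSym p k) * Polynomial.X ^ k -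
    Polynomial.C δ * ∏ k ∈ Finset.range M,
      (Polynomial.X ^ ((M + 1) * (k + 1)) - Polynomial.X ^ (M * (k + 1)))
  have hf : Polynomial.aeval μ f = 0 := by
    simp only [f, map_sub, map_sum, map_mul, map_prod, map_pow, Polynomial.aeval_X,
      Polynomial.aeval_C]
    rw [sub_eq_zero]
    simpa using h
  have hdvd : Polynomial.cyclotomic p ℤ ∣ f := by
    rw [Polynomial.cyclotomic_eq_minpoly hμ hp0]
    exact minpoly.isIntegrallyClosed_dvd (hμ.isIntegral hp0) hf
  obtain ⟨g, hg⟩ := Polynomial.map_dvd (Int.castRingHom (ZMod p)) hdvd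
  have hcyc : Polynomial.cyclotomic p (ZMod p) = (Polynomial.X - 1) ^ (p - 1) := by
    have h1 := Polynomial.cyclotomic_prime_mul_X_sub_one (ZMod p) p
    rw [show (Polynomial.X : Polynomial (ZMod p)) ^ p - 1 = (Polynomial.X - 1) ^ p by
      rw [sub_pow_char, one_pow]] at h1
    have h2 : (Polynomial.X - 1 : Polynomial (ZMod p)) ≠ 0 := Polynomial.X_sub_C_ne_zero 1
    apply mul_right_cancel₀ h2
    rw [h1, ← pow_succ, Nat.sub_add_cancel hp0]
  rw [Polynomial.map_cyclotomic, hcyc] at hg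
  have hq : ∀ k : ℕ, (Polynomial.X ^ ((M + 1) * (k + 1)) - Polynomial.X ^ (M * (k + 1)) :
      Polynomial (ZMod p)) = (Polynomial.X - 1) *
        (Polynomial.X ^ (M * (k + 1)) * ∑ i ∈ Finset.range (k + 1), Polynomial.X ^ i) := by
    intro k
    rw [mul_left_comm, mul_geom_sum]
    ring
  set Q : Polynomial (ZMod p) := ∏ k ∈ Finset.range M,
    (Polynomial.X ^ (M * (k + 1)) * ∑ i ∈ Finset.range (k + 1), Polynomial.X ^ i) with hQ
  have hQ1 : Q.eval 1 = (M.factorial : ZMod p) := by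
    rw [hQ, Polynomial.eval_prod, ← Finset.prod_range_add_one_eq_factorial]
    push_cast
    refine Finset.prod_congr rfl fun k _ => ?_
    simp [Polynomial.eval_finsetSum]
  have hG : ∑ k ∈ Finset.range p, Polynomial.C (legendreSym p k : ZMod p) * Polynomial.X ^ k =
      (Polynomial.X - 1) ^ M * (Polynomial.C (δ : ZMod p) * Q + (Polynomial.X - 1) ^ M * g) := by
    have h1 : p - 1 = M + M := by omega
    simp only [f, Polynomial.map_sub, Polynomial.map_sum, Polynomial.map_mul, Polynomial.map_prod,
      Polynomial.map_pow, Polynomial.map_X, Polynomial.map_C, hq, Finset.prod_mul_distrib,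
      Finset.prod_const, Finset.card_range, ← hQ, h1] at hg
    simp only [eq_intCast] at hg
    linear_combination hg
  have hG2 := congrArg (fun F => Polynomial.eval 1
    ((((LinearMap.mulLeft (ZMod p) (Polynomial.X : Polynomial (ZMod p))) ∘ₗ
      Polynomial.derivative) ^ M) F)) hG
  simp only [eval_pow_X_mul_derivative, map_sum, pow_X_mul_derivative_X_pow] at hG2
  have hM0 : M ≠ 0 := by omega
  simp only [Polynomial.eval_finsetSum, Polynomial.eval_mul, Polynomial.eval_C,
    Polynomial.eval_pow, Polynomial.eval_X, one_pow, mul_one, Polynomial.eval_add, hQ1,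
    Polynomial.eval_sub, Polynomial.eval_one, sub_self, zero_pow hM0, zero_mul, add_zero,
    legendreSym.eq_pow, Int.cast_natCast, ← pow_add] at hG2
  have h2 := sum_range_pow_card_sub_one (p := p)
  rw [show p - 1 = p / 2 + M by omega, hG2] at h2
  have hsq : (M.factorial : ZMod p) * (M.factorial : ZMod p) = 1 := by
    have h1 := factorial_mul_factorial_sub (p := p) (n := M) (by omega)
    rwa [show p - 1 - M = M by omega, Even.neg_one_pow hMo.add_one] at h1
  linear_combination h2 - δ * hsq

open Complex in
/-- The half-system product is a negative multiple of `i` when `p ≡ 3 (mod 4)`. -/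
theorem exists_prod_exp_sub_exp_eq {p : ℕ} (hp4 : p % 4 = 3) :
    ∃ r : ℝ, 0 < r ∧ ∏ k ∈ Finset.range (p / 2),
      (exp (2 * Real.pi * I / p) ^ ((p / 2 + 1) * (k + 1)) -
        exp (2 * Real.pi * I / p) ^ (p / 2 * (k + 1))) = -I * r := by
  have hp0 : (p : ℂ) ≠ 0 := by
    have : p ≠ 0 := by omega
    exact_mod_cast this
  have hp1 : (0 : ℝ) < p := by
    have : 0 < p := by omega
    exact_mod_cast this
  obtain ⟨m, hm⟩ : ∃ m, p = 4 * m + 3 := ⟨p / 4, by omega⟩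
  have hM : p / 2 = 2 * m + 1 := by omega
  have hpM : (p : ℂ) = 2 * ((p / 2 : ℕ) : ℂ) + 1 := by
    have : p = 2 * (p / 2) + 1 := by omega
    exact_mod_cast this
  have hfac : ∀ k : ℕ, exp (2 * Real.pi * I / p) ^ ((p / 2 + 1) * k) -
      exp (2 * Real.pi * I / p) ^ (p / 2 * k) =
        (-1) ^ k * (I * ((2 * Real.sin (Real.pi * k / p) : ℝ) : ℂ)) := by
    intro k
    have h1 : exp (2 * Real.pi * I / p) ^ ((p / 2 + 1) * k) =
        (-1) ^ k * exp (Real.pi * k / p * I) := by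
      rw [← exp_pi_mul_I, ← exp_nat_mul, ← exp_nat_mul, ← exp_add]
      congr 1
      push_cast
      field_simp
      rw [hpM]
      ring
    have h2 : exp (2 * Real.pi * I / p) ^ (p / 2 * k) =
        (-1) ^ k * exp (-(Real.pi * k / p) * I) := by
      rw [← exp_pi_mul_I, ← exp_nat_mul, ← exp_nat_mul, ← exp_add]
      congr 1
      push_cast
      field_simp
      rw [hpM]
      ring
    rw [h1, h2, ← mul_sub]
    congr 1
    push_cast
    rw [Complex.two_sin]
    linear_combination (exp (Real.pi * k / p * I) - exp (-(Real.pi * k / p) * I)) * I_mul_I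
  refine ⟨∏ k ∈ Finset.range (p / 2), (2 * Real.sin (Real.pi * (k + 1 : ℕ) / p)), ?_, ?_⟩
  · refine Finset.prod_pos fun k hk => mul_pos two_pos (Real.sin_pos_of_pos_of_lt_pi ?_ ?_)
    · have := Real.pi_pos
      positivity
    · have h1 := Finset.mem_range.1 hk
      have h2 : ((k + 1 : ℕ) : ℝ) < p := by
        have : k + 1 < p := by omega
        exact_mod_cast this
      rw [div_lt_iff₀ hp1]
      exact mul_lt_mul_of_pos_left h2 Real.pi_pos
  · simp only [hfac]
    rw [Finset.prod_mul_distrib, Finset.prod_mul_distrib, Finset.prod_pow_eq_pow_sum,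
      Finset.prod_const, Finset.card_range, ← ofReal_prod, ← mul_assoc, hM]
    congr 1
    rw [Finset.sum_add_distrib, Finset.sum_range_id, Nat.add_sub_cancel,
      show (2 * m + 1) * (2 * m) = (2 * m + 1) * m * 2 by ring, Nat.mul_div_cancel _ two_pos]
    simp only [Finset.sum_const, Finset.card_range, smul_eq_mul, mul_one]
    rw [show (2 * m + 1) * m + (2 * m + 1) = (2 * m + 1) * (m + 1) by ring, pow_mul,
      Odd.neg_one_pow ⟨m, rfl⟩, pow_succ I, pow_mul, I_sq, pow_succ, ← mul_assoc]
    rw [mul_right_comm _ (-1 : ℂ), ← mul_pow]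
    simp

theorem sq_prod_pow_sub_pow {p : ℕ} (hp4 : p % 4 = 3) {μ : ℂ} (hμ : IsPrimitiveRoot μ p) :
    (∏ k ∈ Finset.range (p / 2), (μ ^ ((p / 2 + 1) * (k + 1)) - μ ^ (p / 2 * (k + 1)))) ^ 2 =
      -(p : ℂ) := by
  have hMo : Odd (p / 2) := by rw [Nat.odd_iff]; omega
  have hpM : p = p / 2 + p / 2 + 1 := by omega
  set M := p / 2 with hM
  have h1 := IsPrimitiveRoot.prod_one_sub_pow_eq_order (n := M + M) (μ := μ) (by rwa [← hpM])
  have h2 : ((M + M : ℕ) : ℂ) + 1 = p := by rw [hpM]; push_cast; ring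
  rw [h2, Finset.prod_range_add, ← Finset.prod_range_reflect (fun k => 1 - μ ^ (M + k + 1)),
    ← Finset.prod_mul_distrib] at h1
  rw [← h1, ← Finset.prod_pow, ← neg_one_mul, ← hMo.neg_one_pow (α := ℂ),
    show ((-1 : ℂ)) ^ M = ∏ _k ∈ Finset.range M, (-1 : ℂ) by simp, ← Finset.prod_mul_distrib]
  refine Finset.prod_congr rfl fun k hk => ?_
  have hk' := Finset.mem_range.1 hk
  obtain ⟨n, hn⟩ : ∃ n, M + (M - 1 - k) + 1 = n := ⟨_, rfl⟩
  rw [hn]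
  have hnk : n + (k + 1) = p := by omega
  have e1 : μ ^ n * μ ^ (k + 1) = 1 := by rw [← pow_add, hnk, hμ.pow_eq_one]
  have e2 : μ ^ (M * (k + 1)) * μ ^ (M * (k + 1)) = μ ^ n := by
    rw [← pow_add, show M * (k + 1) + M * (k + 1) = p * k + n by
      have : M * (k + 1) + M * (k + 1) + (k + 1) = p * (k + 1) := by
        conv_rhs => rw [hpM]
        ring
      nlinarith, pow_add, pow_mul, hμ.pow_eq_one, one_pow, one_mul]
  rw [show (M + 1) * (k + 1) = M * (k + 1) + (k + 1) by ring, pow_add]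
  linear_combination (μ ^ (k + 1) - 1) ^ 2 * e2 + (μ ^ (k + 1) - 2 + 1) * e1

/-- The quadratic Gauss sum as a complex number. -/
noncomputable def quadGaussSum (p : ℕ) [Fact p.Prime] : ℂ :=
  ∑ c : ZMod p, (quadraticChar (ZMod p) c : ℂ) * ZMod.stdAddChar c

theorem quadGaussSum_sq {p : ℕ} [Fact p.Prime] (hp4 : p % 4 = 3) :
    quadGaussSum p ^ 2 = -(p : ℂ) := by
  have h2 : ringChar (ZMod p) ≠ 2 := by rw [ZMod.ringChar_zmod_n]; omega
  have h1 := gaussSum_sq (R := ZMod p) (R' := ℂ)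
    (χ := (quadraticChar (ZMod p)).ringHomComp (Int.castRingHom ℂ))
    ((MulChar.ringHomComp_ne_one_iff (RingHom.injective_int _)).2 (quadraticChar_ne_one h2))
    ((quadraticChar_isQuadratic (ZMod p)).comp _) (ZMod.isPrimitive_stdAddChar p)
  have h3 : quadraticChar (ZMod p) (-1) = -1 := by
    rw [quadraticChar_neg_one h2, ZMod.card, ZMod.χ₄_nat_three_mod_four hp4]
  simpa [gaussSum, h3, quadGaussSum] using h1

theorem quadGaussSum_eq_sum_range {p : ℕ} [Fact p.Prime] :
    quadGaussSum p = ∑ k ∈ Finset.range p, (legendreSym p k : ℂ) *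
      Complex.exp (2 * Real.pi * Complex.I / p) ^ k := by
  have h := sum_range_eq_sum_zmod p
    (fun c : ZMod p => (quadraticChar (ZMod p) c : ℂ) * ZMod.stdAddChar c)
  simp only [Algebra.algebraMap_self, RingHom.id_apply] at h
  rw [quadGaussSum, ← h]
  refine Finset.sum_congr rfl fun k _ => ?_
  have h1 := ZMod.stdAddChar_coe (N := p) (k : ℤ)
  rw [Int.cast_natCast] at h1
  rw [h1, legendreSym, Int.cast_natCast, Int.cast_natCast, ← Complex.exp_nat_mul,
    show 2 * Real.pi * Complex.I * (k : ℂ) / p = k * (2 * Real.pi * Complex.I / p) by ring]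

theorem quadGaussSum_eq {p : ℕ} [Fact p.Prime] (hp4 : p % 4 = 3) :
    quadGaussSum p = Complex.I * (Real.sqrt p : ℂ) := by
  have hμ := Complex.isPrimitiveRoot_exp p (by omega)
  have h1 := quadGaussSum_sq hp4
  have h2 := sq_prod_pow_sub_pow hp4 hμ
  obtain ⟨r, hr, h3⟩ := exists_prod_exp_sub_exp_eq hp4
  have hr2 : r = Real.sqrt p := by
    rw [h3] at h2
    symm
    rw [Real.sqrt_eq_iff_mul_self_eq_of_pos hr]
    have : ((r * r : ℝ) : ℂ) = (p : ℝ) := by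
      push_cast
      linear_combination (-1) * h2 + (r * r) * Complex.I_mul_I
    exact_mod_cast this
  have key : ∀ δ : ℤ, quadGaussSum p = δ * ∏ k ∈ Finset.range (p / 2),
      (Complex.exp (2 * Real.pi * Complex.I / p) ^ ((p / 2 + 1) * (k + 1)) -
        Complex.exp (2 * Real.pi * Complex.I / p) ^ (p / 2 * (k + 1))) → (δ : ZMod p) = -1 := by
    intro δ hδ
    rw [quadGaussSum_eq_sum_range] at hδ
    exact eq_neg_one_of_gaussSum_eq_mul_prod hp4 hμ hδ
  rcases sq_eq_sq_iff_eq_or_eq_neg.1 (h1.trans h2.symm) with h | h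
  · have h4 := key 1 (by rw [h]; simp)
    have : Fact (2 < p) := ⟨by have := (Fact.out : p.Prime).two_le; omega⟩
    rw [Int.cast_one] at h4
    exact absurd h4.symm (ZMod.neg_one_ne_one (n := p))
  · rw [h, h3, hr2]
    ring

theorem sum_quadraticChar_mul_stdAddChar_mul {p : ℕ} [Fact p.Prime] (hp : p ≠ 2) (j : ZMod p) :
    ∑ c : ZMod p, (quadraticChar (ZMod p) c : ℂ) * ZMod.stdAddChar (j * c) =
      quadraticChar (ZMod p) j * quadGaussSum p := by
  have h2 : ringChar (ZMod p) ≠ 2 := by rwa [ZMod.ringChar_zmod_n]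
  rcases eq_or_ne j 0 with rfl | hj
  · have := quadraticChar_sum_zero h2
    simp only [zero_mul, AddChar.map_zero_eq_one, mul_one, MulChar.map_zero, Int.cast_zero]
    exact_mod_cast congrArg (Int.cast : ℤ → ℂ) this
  · have h1 := quadraticChar_sq_one hj
    rw [quadGaussSum, Finset.mul_sum, ← Equiv.sum_comp (Equiv.mulLeft₀ j hj)
      (fun c => (quadraticChar (ZMod p) j : ℂ) *
        ((quadraticChar (ZMod p) c : ℂ) * ZMod.stdAddChar c))]
    refine Finset.sum_congr rfl fun c _ => ?_
    have h1' : (quadraticChar (ZMod p) j : ℂ) * quadraticChar (ZMod p) j = 1 := by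
      rw [← sq]
      exact_mod_cast congrArg (Int.cast : ℤ → ℂ) h1
    simp only [Equiv.mulLeft₀_apply, map_mul, Int.cast_mul]
    linear_combination (-(quadraticChar (ZMod p) c : ℂ) * ZMod.stdAddChar (j * c)) * h1'

theorem sum_range_mul_pow_mul_sub_one {R : Type*} [CommRing R] (n : ℕ) (x : R) :
    (∑ j ∈ Finset.range n, (j : R) * x ^ j) * (x - 1) =
      n * x ^ n - x * ∑ j ∈ Finset.range n, x ^ j := by
  induction n with
  | zero => simp
  | succ n ih =>
    rw [Finset.sum_range_succ, add_mul, ih, Finset.sum_range_succ]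
    push_cast
    ring

theorem cot_eq_of_exp_ne_one {z : ℂ} (hz : Complex.exp (2 * z * Complex.I) ≠ 1) :
    (Complex.exp (2 * z * Complex.I) - 1)⁻¹ = -(1 / 2) - Complex.I / 2 * Complex.cot z := by
  have h1 : Complex.exp (2 * z * Complex.I) - 1 ≠ 0 := sub_ne_zero.2 hz
  rw [Complex.cot_eq_exp_ratio]
  have e : Complex.exp (2 * Complex.I * z) = Complex.exp (2 * z * Complex.I) := by congr 1; ring
  rw [e]
  have h2 : Complex.I * (1 - Complex.exp (2 * z * Complex.I)) ≠ 0 :=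
    mul_ne_zero Complex.I_ne_zero (sub_ne_zero.2 hz.symm)
  generalize Complex.exp (2 * z * Complex.I) = w at *
  have h3 : 1 - w ≠ 0 := right_ne_zero_of_mul h2
  have hI := Complex.I_ne_zero
  field_simp
  ring

theorem sum_legendreSym_mul_cot {p : ℕ} [Fact p.Prime] (hp4 : p % 4 = 3) :
    ∑ k ∈ Finset.range p, (legendreSym p k : ℂ) * Complex.cot (Real.pi * k / p) =
      -2 * ((∑ k ∈ Finset.range p, (k : ℤ) * legendreSym p k : ℤ) : ℂ) / (Real.sqrt p : ℂ) := by
  have hp2 : p ≠ 2 := by omega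
  have hp0 : (p : ℂ) ≠ 0 := by exact_mod_cast (Fact.out : p.Prime).ne_zero
  have hconv : ∀ G : ZMod p → ℂ, ∑ k ∈ Finset.range p, G k = ∑ c : ZMod p, G c := by
    intro G
    have h := sum_range_eq_sum_zmod p G
    simpa only [Algebra.algebraMap_self, RingHom.id_apply] using h
  have hψ : ∀ k : ℕ, (ZMod.stdAddChar (k : ZMod p) : ℂ) =
      Complex.exp (2 * (Real.pi * k / p) * Complex.I) := by
    intro k
    have h1 := ZMod.stdAddChar_coe (N := p) (k : ℤ)
    rw [Int.cast_natCast] at h1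
    rw [h1, Int.cast_natCast]
    congr 1
    ring
  have hsum : ∑ k ∈ Finset.range p, (legendreSym p k : ℂ) = 0 := by
    have := hconv fun c => (quadraticChar (ZMod p) c : ℂ)
    simp only [legendreSym, Int.cast_natCast]
    rw [this]
    exact_mod_cast congrArg (Int.cast : ℤ → ℂ)
      (quadraticChar_sum_zero (F := ZMod p) (by rwa [ZMod.ringChar_zmod_n]))
  have hterm : ∀ k ∈ Finset.range p, (legendreSym p k : ℂ) *
      ∑ j ∈ Finset.range p, (j : ℂ) * ZMod.stdAddChar ((j : ZMod p) * (k : ZMod p)) =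
        p * ((legendreSym p k : ℂ) *
          (-(1 / 2) - Complex.I / 2 * Complex.cot (Real.pi * k / p))) := by
    intro k hk
    rcases Nat.eq_zero_or_pos k with rfl | hk0
    · simp
    have hk1 : (k : ZMod p) ≠ 0 := by
      rw [Ne, ZMod.natCast_eq_zero_iff]
      intro h
      exact absurd (Nat.le_of_dvd hk0 h) (not_le.2 (Finset.mem_range.1 hk))
    have hne : (ZMod.stdAddChar (k : ZMod p) : ℂ) ≠ 1 := by
      rw [← AddChar.map_zero_eq_one (ZMod.stdAddChar (N := p))]
      exact fun h => hk1 (ZMod.injective_stdAddChar h)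
    have hpow : (ZMod.stdAddChar (k : ZMod p) : ℂ) ^ p = 1 := by
      rw [← AddChar.map_nsmul_eq_pow]
      simp
    rw [← cot_eq_of_exp_ne_one (by rwa [← hψ]), ← hψ]
    have h1 : ∀ j : ℕ, (ZMod.stdAddChar ((j : ZMod p) * (k : ZMod p)) : ℂ) =
        (ZMod.stdAddChar (k : ZMod p) : ℂ) ^ j := by
      intro j
      rw [← AddChar.map_nsmul_eq_pow, nsmul_eq_mul]
    simp only [h1]
    have h2 := sum_range_mul_pow_mul_sub_one p (ZMod.stdAddChar (k : ZMod p) : ℂ)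
    have h3 := mul_geom_sum (ZMod.stdAddChar (k : ZMod p) : ℂ) p
    generalize (ZMod.stdAddChar (k : ZMod p) : ℂ) = x at *
    have hx : x - 1 ≠ 0 := sub_ne_zero.2 hne
    rw [hpow, sub_self] at h3
    rw [(mul_eq_zero.1 h3).resolve_left hx, hpow] at h2
    field_simp
    linear_combination (legendreSym p k : ℂ) * h2
  have hmain : ∑ k ∈ Finset.range p, (legendreSym p k : ℂ) *
      ∑ j ∈ Finset.range p, (j : ℂ) * ZMod.stdAddChar ((j : ZMod p) * (k : ZMod p)) =
        ((∑ k ∈ Finset.range p, (k : ℤ) * legendreSym p k : ℤ) : ℂ) * quadGaussSum p := by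
    simp only [Finset.mul_sum]
    rw [Finset.sum_comm]
    push_cast
    rw [Finset.sum_mul]
    refine Finset.sum_congr rfl fun j _ => ?_
    have h1 := hconv fun c => (quadraticChar (ZMod p) c : ℂ) * ZMod.stdAddChar ((j : ZMod p) * c)
    rw [sum_quadraticChar_mul_stdAddChar_mul hp2] at h1
    simp only [legendreSym, Int.cast_natCast]
    rw [mul_assoc, ← h1, Finset.mul_sum]
    exact Finset.sum_congr rfl fun k _ => by ring
  rw [Finset.sum_congr rfl hterm, ← Finset.mul_sum, quadGaussSum_eq hp4] at hmain
  have h4 : ∑ k ∈ Finset.range p, (legendreSym p k : ℂ) *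
      (-(1 / 2) - Complex.I / 2 * Complex.cot (Real.pi * k / p)) =
      -(1 / 2) * ∑ k ∈ Finset.range p, (legendreSym p k : ℂ) - Complex.I / 2 *
        ∑ k ∈ Finset.range p, (legendreSym p k : ℂ) * Complex.cot (Real.pi * k / p) := by
    rw [Finset.mul_sum, Finset.mul_sum, ← Finset.sum_sub_distrib]
    exact Finset.sum_congr rfl fun k _ => by ring
  rw [h4, hsum] at hmain
  have hs : (Real.sqrt p : ℂ) * (Real.sqrt p : ℂ) = p := by
    rw [← Complex.ofReal_mul, Real.mul_self_sqrt (Nat.cast_nonneg p), Complex.ofReal_natCast]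
  have hs0 : (Real.sqrt p : ℂ) ≠ 0 := by
    intro h
    rw [h, zero_mul] at hs
    exact hp0 hs.symm
  rw [eq_div_iff hs0]
  generalize ∑ k ∈ Finset.range p, (legendreSym p k : ℂ) * Complex.cot (Real.pi * k / p) = A at *
  generalize ((∑ k ∈ Finset.range p, (k : ℤ) * legendreSym p k : ℤ) : ℂ) = S at *
  have hI := Complex.I_ne_zero
  rw [← hs] at hmain
  have h5 : (Real.sqrt p : ℂ) * Complex.I * (A * (Real.sqrt p : ℂ)) =
      (Real.sqrt p : ℂ) * Complex.I * (-2 * S) := by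
    linear_combination (-2) * hmain
  exact mul_left_cancel₀ (mul_ne_zero hs0 hI) h5

theorem one_div_rpow_sub_le {n s : ℝ} (hn : 1 ≤ n) (hs : s ∈ Set.Icc (1 : ℝ) 2) :
    1 / n ^ s - 1 / (n + 1) ^ s ≤ 2 / n ^ 2 := by
  have hn0 : 0 < n := by linarith
  have h1 : (n / (n + 1)) ^ 2 ≤ (n / (n + 1)) ^ s := by
    rw [← Real.rpow_two]
    exact Real.rpow_le_rpow_of_exponent_ge (by positivity)
      ((div_le_one (by positivity)).2 (by linarith)) hs.2
  rw [Real.div_rpow hn0.le (by linarith)] at h1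
  have h2 : n ≤ n ^ s := by
    conv_lhs => rw [← Real.rpow_one n]
    exact Real.rpow_le_rpow_of_exponent_le hn hs.1
  have h3 : 1 / n ^ s - 1 / (n + 1) ^ s = (1 - n ^ s / (n + 1) ^ s) / n ^ s := by
    field_simp
  rw [h3]
  have h4 : 1 - (n / (n + 1)) ^ 2 ≤ 2 / n := by
    rw [div_pow, sub_le_iff_le_add, div_add_div _ _ (by positivity) (by positivity),
      le_div_iff₀ (by positivity)]
    nlinarith
  calc (1 - n ^ s / (n + 1) ^ s) / n ^ s ≤ (2 / n) / n ^ s := by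
        gcongr; linarith
    _ ≤ (2 / n) / n := by gcongr
    _ = 2 / n ^ 2 := by rw [div_div, sq]

theorem norm_hurwitz_odd_term_le {a s : ℝ} (ha : a ∈ Set.Ioo (0 : ℝ) 1) (hs : s ∈ Set.Icc (1 : ℝ) 2)
    (n : ℕ) : ‖(1 / (n + a : ℂ) ^ (s : ℂ) - 1 / (n + 1 - a : ℂ) ^ (s : ℂ)) / 2‖ ≤
      2 / (n : ℝ) ^ 2 + if n = 0 then 1 / a ^ 2 + 1 / (1 - a) ^ 2 else 0 := by
  have ha0 := ha.1
  have ha1 := ha.2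
  have hn0 : (0 : ℝ) ≤ n := Nat.cast_nonneg n
  have h1 : (1 / (n + a : ℂ) ^ (s : ℂ) - 1 / (n + 1 - a : ℂ) ^ (s : ℂ)) / 2 =
      (((1 / ((n : ℝ) + a) ^ s - 1 / ((n : ℝ) + 1 - a) ^ s) / 2 : ℝ) : ℂ) := by
    push_cast [Complex.ofReal_cpow (show 0 ≤ (n : ℝ) + a by linarith),
      Complex.ofReal_cpow (show 0 ≤ (n : ℝ) + 1 - a by linarith)]
    rfl
  rw [h1, Complex.norm_real, Real.norm_eq_abs]
  have hs0 : 0 ≤ s := by linarith [hs.1]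
  rcases Nat.eq_zero_or_pos n with rfl | hn
  · have h2 : ∀ b ∈ Set.Ioo (0 : ℝ) 1, 0 ≤ 1 / b ^ s ∧ 1 / b ^ s ≤ 1 / b ^ 2 := by
      intro b hb
      have hb0 := hb.1
      refine ⟨by positivity, one_div_le_one_div_of_le (by positivity) ?_⟩
      rw [← Real.rpow_two]
      exact Real.rpow_le_rpow_of_exponent_ge hb0 hb.2.le hs.2
    have h3 := h2 a ha
    have h4 := h2 (1 - a) ⟨by linarith, by linarith⟩
    simp only [Nat.cast_zero, zero_add, if_true, ne_eq, OfNat.ofNat_ne_zero, not_false_eq_true,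
      zero_pow, div_zero]
    rw [abs_le]
    constructor <;> linarith
  · have hn1 : (1 : ℝ) ≤ n := by exact_mod_cast hn
    have h2 : ∀ x : ℝ, (n : ℝ) ≤ x → x ≤ n + 1 →
        1 / ((n : ℝ) + 1) ^ s ≤ 1 / x ^ s ∧ 1 / x ^ s ≤ 1 / (n : ℝ) ^ s := by
      intro x hx1 hx2
      have hx : 0 < x := by linarith
      constructor <;> exact one_div_le_one_div_of_le (by positivity)
        (Real.rpow_le_rpow (by linarith) (by linarith) hs0)
    have h3 := h2 (n + a) (by linarith) (by linarith)
    have h4 := h2 (n + 1 - a) (by linarith) (by linarith)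
    have h5 := one_div_rpow_sub_le hn1 hs
    have h6 : 0 ≤ 2 / (n : ℝ) ^ 2 := by positivity
    rw [if_neg hn.ne', add_zero, abs_le]
    constructor <;> linarith

theorem hurwitzZetaOdd_one_eq_cot {a : ℝ} (ha : a ∈ Set.Ioo (0 : ℝ) 1) :
    HurwitzZeta.hurwitzZetaOdd a 1 = Real.pi / 2 * Complex.cot (Real.pi * a) := by
  set g : ℕ → ℝ := fun n =>
    2 / (n : ℝ) ^ 2 + if n = 0 then 1 / a ^ 2 + 1 / (1 - a) ^ 2 else 0 with hg
  have hgs : Summable g := by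
    refine Summable.add ?_ (hasSum_ite_eq 0 _).summable
    simpa [div_eq_mul_inv] using (Real.summable_nat_pow_inv.2 one_lt_two).mul_left (2 : ℝ)
  set t : ℝ → ℕ → ℂ := fun s n =>
    (1 / (n + a : ℂ) ^ (s : ℂ) - 1 / (n + 1 - a : ℂ) ^ (s : ℂ)) / 2 with ht
  have hbase : ∀ n : ℕ, (n + a : ℂ) ≠ 0 ∧ (n + 1 - a : ℂ) ≠ 0 := by
    intro n
    have h0 : (0 : ℝ) ≤ n := Nat.cast_nonneg n
    have h1 : (n + a : ℝ) ≠ 0 := by linarith [ha.1]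
    have h2 : (n + 1 - a : ℝ) ≠ 0 := by linarith [ha.2]
    exact ⟨by exact_mod_cast h1, by exact_mod_cast h2⟩
  have hlim1 : Filter.Tendsto (fun s : ℝ => ∑' n, t s n) (nhdsWithin 1 (Set.Ioi 1))
      (nhds (∑' n, t 1 n)) := by
    refine tendsto_tsum_of_dominated_convergence hgs (fun n => ?_) ?_
    · have : ContinuousAt (fun s : ℝ => t s n) 1 := by
        have h3 : ∀ b : ℂ, b ≠ 0 → ContinuousAt (fun s : ℝ => 1 / b ^ (s : ℂ)) 1 := by
          intro b hb
          refine ContinuousAt.div continuousAt_const ?_ (by simp [Complex.cpow_eq_zero_iff, hb])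
          exact (continuousAt_const_cpow hb).comp Complex.continuous_ofReal.continuousAt
        exact ((h3 _ (hbase n).1).sub (h3 _ (hbase n).2)).div_const 2
      exact this.tendsto.mono_left nhdsWithin_le_nhds
    · filter_upwards [Ioc_mem_nhdsGT (show (1 : ℝ) < 2 by norm_num)] with s hs n
      exact norm_hurwitz_odd_term_le ha ⟨hs.1.le, hs.2⟩ n
  have hlim2 : Filter.Tendsto (fun s : ℝ => ∑' n, t s n) (nhdsWithin 1 (Set.Ioi 1))
      (nhds (HurwitzZeta.hurwitzZetaOdd a 1)) := by
    have h1 : Filter.Tendsto (fun s : ℝ => HurwitzZeta.hurwitzZetaOdd a (s : ℂ))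
        (nhdsWithin 1 (Set.Ioi 1)) (nhds (HurwitzZeta.hurwitzZetaOdd a ((1 : ℝ) : ℂ))) :=
      (((HurwitzZeta.differentiable_hurwitzZetaOdd a).continuous.comp
        Complex.continuous_ofReal).tendsto 1).mono_left nhdsWithin_le_nhds
    rw [Complex.ofReal_one] at h1
    refine h1.congr' ?_
    filter_upwards [self_mem_nhdsWithin] with s hs
    exact (HurwitzZeta.hasSum_nat_hurwitzZetaOdd_of_mem_Icc ⟨ha.1.le, ha.2.le⟩
      (by simpa using hs)).tsum_eq.symm
  have h1 := tendsto_nhds_unique hlim2 hlim1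
  have hsum : HasSum (t 1) (HurwitzZeta.hurwitzZetaOdd a 1) := by
    rw [h1]
    refine Summable.hasSum (hgs.of_norm_bounded fun n => ?_)
    exact norm_hurwitz_odd_term_le ha ⟨le_rfl, one_le_two⟩ n
  have hx : (a : ℂ) ∈ Complex.integerComplement := by
    rintro ⟨n, hn⟩
    have : (n : ℝ) = a := by exact_mod_cast hn
    have h2 := ha.1
    have h3 := ha.2
    rw [← this] at h2 h3
    have h4 : 0 < n := by exact_mod_cast h2
    have h5 : n < 1 := by exact_mod_cast h3
    omega
  have hcot := (summable_cotTerm hx).hasSum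
  have hcot2 := hcot.tendsto_sum_nat
  have hsum2 := hsum.tendsto_sum_nat
  rw [show (∑' n, cotTerm (a : ℂ) n) = Real.pi * Complex.cot (Real.pi * a) - 1 / a from
    (cot_series_rep' hx).symm] at hcot2
  have hdiff : ∀ N : ℕ, ∑ n ∈ Finset.range N, cotTerm (a : ℂ) n + 1 / a =
      2 * ∑ n ∈ Finset.range N, t 1 n + 1 / ((N : ℂ) + a) := by
    intro N
    induction N with
    | zero => simp
    | succ N ih =>
      rw [Finset.sum_range_succ, Finset.sum_range_succ, add_right_comm, ih]
      simp only [ht, cotTerm, Complex.ofReal_one, Complex.cpow_one]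
      have h3 := (hbase N).2
      have h4 := (hbase (N + 1)).1
      push_cast at h4 ⊢
      have h5 : (a : ℂ) - (N + 1) = -(N + 1 - a) := by ring
      have h6 : (a : ℂ) + (N + 1) = N + 1 + a := by ring
      rw [h5, h6, one_div_neg_eq_neg_one_div]
      ring
  have hz : Filter.Tendsto (fun N : ℕ => 1 / ((N : ℂ) + a)) Filter.atTop (nhds 0) := by
    have h7 : Filter.Tendsto (fun N : ℕ => 1 / ((N : ℝ) + a)) Filter.atTop (nhds 0) :=
      tendsto_const_nhds.div_atTop
        (Filter.tendsto_atTop_add_const_right _ _ tendsto_natCast_atTop_atTop)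
    have h8 := (Complex.continuous_ofReal.tendsto 0).comp h7
    simpa [Function.comp_def] using h8
  have h9 := (hcot2.add_const (1 / (a : ℂ))).congr hdiff
  have h10 := (hsum2.const_mul 2).add hz
  have h11 := tendsto_nhds_unique h9 h10
  linear_combination (-1 / 2) * h11

theorem LFunction_quadraticChar_one (p : ℕ) [Fact p.Prime] (hp4 : p % 4 = 3) :
    ZMod.LFunction (fun c : ZMod p => (quadraticChar (ZMod p) c : ℂ)) 1 =
      -(Real.pi * ((∑ k ∈ Finset.range p, (k:ℤ) * legendreSym p k : ℤ) : ℂ)) /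
        (p * (Real.sqrt p : ℂ)) := by
  have hp : p.Prime := Fact.out
  have hodd : Function.Odd (fun c : ZMod p => (quadraticChar (ZMod p) c : ℂ)) := by
    intro c
    have h1 : quadraticChar (ZMod p) (-1) = -1 := by
      have := legendreSym.at_neg_one (p := p) (by omega)
      rw [ZMod.χ₄_nat_three_mod_four hp4] at this
      simpa [legendreSym] using this
    have h2 : quadraticChar (ZMod p) (-c) = -quadraticChar (ZMod p) c := by
      rw [← neg_one_mul, map_mul, h1, neg_one_mul]
    simp only [h2]
    push_cast; rfl
  rw [ZMod.LFunction_def_odd hodd]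
  have h1 := sum_legendreSym_mul_cot hp4
  have h2 : ∀ j : ZMod p, (quadraticChar (ZMod p) j : ℂ) *
      HurwitzZeta.hurwitzZetaOdd (ZMod.toAddCircle j) 1 = (Real.pi / 2) *
        ((quadraticChar (ZMod p) j : ℂ) * Complex.cot (Real.pi * j.val / p)) := by
    intro j
    rcases eq_or_ne j 0 with rfl | hj
    · simp
    · have hpos : (0 : ℝ) < p := by exact_mod_cast hp.pos
      have h3 : (0 : ℝ) < j.val := by
        exact_mod_cast Nat.pos_of_ne_zero (by rwa [ne_eq, ZMod.val_eq_zero])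
      have h4 : (j.val : ℝ) < p := by exact_mod_cast ZMod.val_lt j
      rw [ZMod.toAddCircle_apply, hurwitzZetaOdd_one_eq_cot
        ⟨by positivity, (div_lt_one hpos).2 h4⟩]
      push_cast
      rw [mul_div_assoc (Real.pi : ℂ) _ (p : ℂ)]
      ring
  rw [Finset.sum_congr rfl fun j _ => h2 j, ← Finset.mul_sum]
  have h5 : ∑ j : ZMod p, (quadraticChar (ZMod p) j : ℂ) * Complex.cot (Real.pi * j.val / p) =
      ∑ k ∈ Finset.range p, (legendreSym p k : ℂ) * Complex.cot (Real.pi * k / p) := by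
    have h6 := sum_range_eq_sum_zmod p fun j : ZMod p =>
      (quadraticChar (ZMod p) j : ℂ) * Complex.cot (Real.pi * j.val / p)
    simp only [Algebra.algebraMap_self, RingHom.id_apply] at h6
    rw [← h6]
    refine Finset.sum_congr rfl fun k hk => ?_
    rw [ZMod.val_cast_of_lt (Finset.mem_range.1 hk), legendreSym, Int.cast_natCast]
  rw [h5, h1, Complex.cpow_neg_one]
  have := hp.ne_zero
  field_simp

theorem tendsto_LSeries_quadraticChar (p : ℕ) [Fact p.Prime] (hp4 : p % 4 = 3) :
    Filter.Tendsto (fun s : ℝ => LSeries (fun n : ℕ => (quadraticChar (ZMod p) n : ℂ)) s)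
      (nhdsWithin 1 (Set.Ioi 1)) (nhds (-(Real.pi *
        ((∑ k ∈ Finset.range p, (k:ℤ) * legendreSym p k : ℤ) : ℂ)) /
        (p * (Real.sqrt p : ℂ)))) := by
  have hsum : ∑ c : ZMod p, (quadraticChar (ZMod p) c : ℂ) = 0 := by
    have : ringChar (ZMod p) ≠ 2 := by
      rw [ZMod.ringChar_zmod_n]; omega
    exact_mod_cast quadraticChar_sum_zero this
  rw [← LFunction_quadraticChar_one p hp4]
  have h1 := (((ZMod.differentiable_LFunction_of_sum_zero hsum).continuous.comp
        Complex.continuous_ofReal).tendsto 1).mono_left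
        (nhdsWithin_le_nhds (s := Set.Ioi (1 : ℝ)))
  simp only [Function.comp_def, Complex.ofReal_one] at h1
  refine h1.congr' ?_
  filter_upwards [self_mem_nhdsWithin] with s hs
  exact ZMod.LFunction_eq_LSeries _ (by simpa using hs)

section

open NumberField

section QuadraticBasis

variable {R S : Type*} [CommRing R] [CommRing S] [Algebra R S] (b : Module.Basis (Fin 2) R S)
  {c d : R} (h0 : b 0 = 1) (h1 : b 1 * b 1 = algebraMap R S c + d • b 1)
include h0

theorem repr_quadratic (u v : R) :
    b.repr (algebraMap R S u + v • b 1) = Finsupp.single 0 u + Finsupp.single 1 v := by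
  rw [Algebra.algebraMap_eq_smul_one, ← h0]
  simp

theorem eq_repr_quadratic (x : S) : x = algebraMap R S (b.repr x 0) + b.repr x 1 • b 1 := by
  conv_lhs => rw [← b.sum_repr x]
  rw [Fin.sum_univ_two, h0, Algebra.algebraMap_eq_smul_one]

theorem ringHom_ext_quadratic {A : Type*} [CommRing A] {φ ψ : S →+* A}
    (hR : φ.comp (algebraMap R S) = ψ.comp (algebraMap R S)) (hw : φ (b 1) = ψ (b 1)) : φ = ψ := by
  ext x
  have hR2 : ∀ u : R, φ (algebraMap R S u) = ψ (algebraMap R S u) := fun u => RingHom.congr_fun hR u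
  rw [eq_repr_quadratic b h0 x]
  simp only [Algebra.smul_def, map_add, map_mul, hR2, hw]

include h1

theorem exists_ringHom_quadratic {A : Type*} [CommRing A] (f : R →+* A) {r : A}
    (hr : r * r = f c + f d * r) : ∃ φ : S →+* A, φ (b 1) = r := by
  have hφ : ∀ u v : R, f (b.repr (algebraMap R S u + v • b 1) 0) +
      f (b.repr (algebraMap R S u + v • b 1) 1) * r = f u + f v * r := by
    intro u v
    rw [repr_quadratic b h0]
    simp
  refine ⟨{ toFun := fun x => f (b.repr x 0) + f (b.repr x 1) * r, map_one' := ?_, map_mul' := ?_,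
            map_zero' := ?_, map_add' := ?_ }, ?_⟩
  · have := hφ 1 0
    simpa using this
  · intro x y
    have e : x * y = algebraMap R S (b.repr x 0 * b.repr y 0 + b.repr x 1 * b.repr y 1 * c) +
        (b.repr x 0 * b.repr y 1 + b.repr x 1 * b.repr y 0 + b.repr x 1 * b.repr y 1 * d) •
          b 1 := by
      conv_lhs => rw [eq_repr_quadratic b h0 x, eq_repr_quadratic b h0 y]
      simp only [Algebra.smul_def, map_add, map_mul] at h1 ⊢
      linear_combination algebraMap R S (b.repr x 1) * algebraMap R S (b.repr y 1) * h1
    conv_lhs => rw [e]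
    rw [hφ]
    simp only [map_add, map_mul]
    linear_combination -f (b.repr x 1) * f (b.repr y 1) * hr
  · simp
  · intro x y
    simp only [map_add, Finsupp.add_apply]
    ring
  · have := hφ 0 1
    simpa using this

theorem leftMulMatrix_quadratic (x y : R) :
    Algebra.leftMulMatrix b (algebraMap R S x + y • b 1) = !![x, y * c; y, x + y * d] := by
  have e1 : (algebraMap R S x + y • b 1) * b 1 =
      algebraMap R S (y * c) + (x + y * d) • b 1 := by
    rw [add_mul, smul_mul_assoc, h1]
    simp only [Algebra.smul_def, map_add, map_mul]
    ring
  ext i j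
  rw [Algebra.leftMulMatrix_eq_repr_mul]
  fin_cases j
  · simp only [Fin.zero_eta, h0, mul_one, repr_quadratic b h0]
    fin_cases i <;> simp
  · simp only [Fin.mk_one, e1, repr_quadratic b h0]
    fin_cases i <;> simp

theorem trace_quadratic (x y : R) :
    Algebra.trace R S (algebraMap R S x + y • b 1) = 2 * x + y * d := by
  rw [Algebra.trace_eq_matrix_trace b, leftMulMatrix_quadratic b h0 h1, Matrix.trace_fin_two]
  simp
  ring

theorem norm_quadratic (x y : R) :
    Algebra.norm R (algebraMap R S x + y • b 1) = x ^ 2 + d * x * y - c * y ^ 2 := by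
  rw [Algebra.norm_eq_matrix_det b, leftMulMatrix_quadratic b h0 h1, Matrix.det_fin_two]
  simp
  ring

end QuadraticBasis

section ImaginaryQuadratic

variable {p : ℕ} [Fact p.Prime] {K : Type*} [Field K] [NumberField K] {α : K}
  (hα : α ^ 2 = -(p : K)) (hgen : Algebra.adjoin ℚ {α} = ⊤)

include hα in
theorem linearIndependent_one_sqrt_neg : LinearIndependent ℚ ![(1 : K), α] := by
  rw [LinearIndependent.pair_iff]
  intro s t h
  have hp : (0 : ℚ) < p := by exact_mod_cast (Fact.out : p.Prime).pos
  simp only [Algebra.smul_def, mul_one] at h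
  have h2 : algebraMap ℚ K (s ^ 2 + t ^ 2 * p) = 0 := by
    simp only [map_add, map_mul, map_pow, map_natCast]
    linear_combination (algebraMap ℚ K s - algebraMap ℚ K t * α) * h + (algebraMap ℚ K t) ^ 2 * hα
  have h3 : s ^ 2 + t ^ 2 * p = 0 := (algebraMap ℚ K).injective (by rw [h2, map_zero])
  have ht : t ^ 2 * p = 0 := by nlinarith [sq_nonneg s, mul_nonneg (sq_nonneg t) hp.le]
  have ht0 : t = 0 := by simpa [hp.ne'] using ht
  subst ht0
  exact ⟨by simpa using h3, rfl⟩

include hα hgen in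
theorem span_one_sqrt_neg : ⊤ ≤ Submodule.span ℚ (Set.range ![(1 : K), α]) := by
  intro x _
  have hx : x ∈ Algebra.adjoin ℚ {α} := hgen ▸ Algebra.mem_top
  have hr : Set.range ![(1 : K), α] = {1, α} := by simp [Set.pair_comm]
  rw [hr]
  induction hx using Algebra.adjoin_induction with
  | mem x hx => exact Submodule.subset_span (by simp_all)
  | algebraMap r =>
    rw [Algebra.algebraMap_eq_smul_one]
    exact Submodule.smul_mem _ _ (Submodule.subset_span (by simp))
  | add x y _ _ hx hy => exact add_mem (hx trivial) (hy trivial)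
  | mul x y _ _ hx hy =>
    obtain ⟨a, b, rfl⟩ := Submodule.mem_span_pair.1 (hx trivial)
    obtain ⟨c, d, rfl⟩ := Submodule.mem_span_pair.1 (hy trivial)
    refine Submodule.mem_span_pair.2 ⟨a * c - b * d * p, a * d + b * c, ?_⟩
    simp only [Algebra.smul_def, map_add, map_sub, map_mul, map_natCast]
    linear_combination -(algebraMap ℚ K b) * (algebraMap ℚ K d) * hα

/-- The `ℚ`-basis `1, √-p` of `ℚ(√-p)`. -/
noncomputable def sqrtBasis : Module.Basis (Fin 2) ℚ K :=
  Module.Basis.mk (linearIndependent_one_sqrt_neg hα) (span_one_sqrt_neg hα hgen)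

theorem sqrtBasis_zero : sqrtBasis hα hgen 0 = 1 := by simp [sqrtBasis]

theorem sqrtBasis_one : sqrtBasis hα hgen 1 = α := by simp [sqrtBasis]

include hα hgen in
theorem exists_eq_add_of_isIntegral (hp4 : p % 4 = 3) {x : K} (hx : IsIntegral ℤ x) :
    ∃ m n : ℤ, x = m + n * ((1 + α) / 2) := by
  have hsq : sqrtBasis hα hgen 1 * sqrtBasis hα hgen 1 =
      algebraMap ℚ K (-p) + (0 : ℚ) • sqrtBasis hα hgen 1 := by
    rw [sqrtBasis_one, ← sq, hα]; simp
  obtain ⟨a, b, hab⟩ : ∃ a b : ℚ, x = algebraMap ℚ K a + b • sqrtBasis hα hgen 1 :=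
    ⟨_, _, eq_repr_quadratic _ (sqrtBasis_zero hα hgen) x⟩
  obtain ⟨t, ht⟩ := IsIntegrallyClosed.isIntegral_iff.1 (Algebra.isIntegral_trace (L := ℚ) hx)
  obtain ⟨N, hN⟩ := IsIntegrallyClosed.isIntegral_iff.1 (Algebra.isIntegral_norm ℚ hx)
  rw [hab, trace_quadratic _ (sqrtBasis_zero hα hgen) hsq] at ht
  rw [hab, norm_quadratic _ (sqrtBasis_zero hα hgen) hsq] at hN
  simp only [algebraMap_int_eq, eq_intCast] at ht hN
  have hpn : p.Prime := Fact.out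
  have h1 : (p : ℚ) * (2 * b) ^ 2 = ((4 * N - t ^ 2 : ℤ) : ℚ) := by
    push_cast; rw [ht, hN]; ring
  have h2 : IsIntegral ℤ (p * (2 * b)) := by
    refine IsIntegral.of_pow two_pos ?_
    have : ((p : ℚ) * (2 * b)) ^ 2 = algebraMap ℤ ℚ (p * (4 * N - t ^ 2)) := by
      rw [algebraMap_int_eq, eq_intCast]; push_cast at h1 ⊢; linear_combination (p : ℚ) * h1
    rw [this]; exact isIntegral_algebraMap
  obtain ⟨u, hu⟩ := IsIntegrallyClosed.isIntegral_iff.1 h2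
  simp only [algebraMap_int_eq, eq_intCast] at hu
  have h3 : u ^ 2 = p * (4 * N - t ^ 2) := by
    have : (u : ℚ) ^ 2 = p * (4 * N - t ^ 2) := by
      rw [hu]; push_cast at h1; linear_combination (p : ℚ) * h1
    exact_mod_cast this
  obtain ⟨n, rfl⟩ : (p : ℤ) ∣ u := (Nat.prime_iff_prime_int.1 hpn).dvd_of_dvd_pow ⟨_, h3⟩
  have hp0 : (p : ℚ) ≠ 0 := by exact_mod_cast hpn.ne_zero
  have hn : (n : ℚ) = 2 * b := by
    push_cast at hu; exact mul_left_cancel₀ hp0 hu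
  have h4 : t ^ 2 + p * n ^ 2 = 4 * N := by
    have : (t : ℚ) ^ 2 + p * n ^ 2 = 4 * N := by rw [hn, h1]; push_cast; ring
    exact_mod_cast this
  have h5 : (2 : ℤ) ∣ t - n := by
    obtain ⟨k, hk⟩ : ∃ k : ℤ, (p : ℤ) = 2 * k + 1 := ⟨p / 2, by omega⟩
    have h6 : Even (t ^ 2 + p * n ^ 2) := by rw [h4]; exact ⟨2 * N, by ring⟩
    have hpo : ¬ Even (p : ℤ) := by rw [Int.not_even_iff_odd]; exact ⟨k, hk⟩
    rw [← even_iff_two_dvd, Int.even_sub]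
    simpa [Int.even_add, Int.even_mul, Int.even_pow, hpo] using h6
  obtain ⟨m, hm⟩ := h5
  refine ⟨m, n, ?_⟩
  have ha : a = m + n / 2 := by
    have : (t : ℚ) - n = 2 * m := by exact_mod_cast hm
    linarith
  have hb : b = n / 2 := by linarith
  rw [hab, sqrtBasis_one, Algebra.smul_def, ha, hb]
  simp only [map_add, map_div₀, map_intCast, map_ofNat]
  ring

variable (hp4 : p % 4 = 3)

include hα hp4 in
theorem half_one_add_mul_self :
    (1 + α) / 2 * ((1 + α) / 2) = -(((p + 1) / 4 : ℕ) : K) + (1 + α) / 2 := by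
  obtain ⟨k, hk⟩ : ∃ k, p = 4 * k + 3 := ⟨p / 4, by omega⟩
  have h1 : (p + 1) / 4 = k + 1 := by omega
  rw [h1]
  have h2 : (p : K) = 4 * k + 3 := by rw [hk]; push_cast; ring
  rw [h2] at hα
  push_cast
  field_simp
  linear_combination hα

include hα hp4 in
theorem isIntegral_half_one_add : IsIntegral ℤ ((1 + α) / 2) := by
  refine ⟨Polynomial.X ^ 2 - Polynomial.X + Polynomial.C (((p + 1) / 4 : ℕ) : ℤ), ?_, ?_⟩
  · monicity!
  · have := half_one_add_mul_self hα hp4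
    simp only [Polynomial.eval₂_add, Polynomial.eval₂_sub, Polynomial.eval₂_X_pow,
      Polynomial.eval₂_X, Polynomial.eval₂_natCast, eq_intCast, Int.cast_natCast]
    linear_combination this

/-- The algebraic integer `(1 + √-p) / 2`. -/
noncomputable def halfOneAdd : 𝓞 K := ⟨(1 + α) / 2, isIntegral_half_one_add hα hp4⟩

theorem coe_halfOneAdd : (halfOneAdd hα hp4 : K) = (1 + α) / 2 := rfl

theorem halfOneAdd_mul_self : halfOneAdd hα hp4 * halfOneAdd hα hp4 =
    -(((p + 1) / 4 : ℕ) : 𝓞 K) + halfOneAdd hα hp4 := by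
  apply RingOfIntegers.ext
  push_cast [coe_halfOneAdd]
  exact_mod_cast half_one_add_mul_self hα hp4

theorem linearIndependent_one_halfOneAdd :
    LinearIndependent ℤ ![(1 : 𝓞 K), halfOneAdd hα hp4] := by
  rw [LinearIndependent.pair_iff]
  intro s t h
  have h1 := congrArg (algebraMap (𝓞 K) K) h
  rw [map_add, map_zsmul, map_zsmul, map_one, map_zero, zsmul_eq_mul, zsmul_eq_mul, mul_one,
    show algebraMap (𝓞 K) K (halfOneAdd hα hp4) = (1 + α) / 2 from rfl] at h1
  have h3 := linearIndependent_one_sqrt_neg hα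
  rw [LinearIndependent.pair_iff] at h3
  have h2 := h3 (s + t / 2) (t / 2) (by
      simp only [Algebra.smul_def, map_add, map_div₀, map_intCast, map_ofNat]
      linear_combination h1)
  have ht : (t : ℚ) = 0 := by linarith [h2.2]
  have hs : (s : ℚ) = 0 := by linarith [h2.1]
  exact ⟨by exact_mod_cast hs, by exact_mod_cast ht⟩

include hgen in
theorem span_one_halfOneAdd :
    ⊤ ≤ Submodule.span ℤ (Set.range ![(1 : 𝓞 K), halfOneAdd hα hp4]) := by
  intro x _
  obtain ⟨m, n, h⟩ := exists_eq_add_of_isIntegral hα hgen hp4 x.2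
  have hr : Set.range ![(1 : 𝓞 K), halfOneAdd hα hp4] = {1, halfOneAdd hα hp4} := by
    simp [Set.pair_comm]
  rw [hr]
  refine Submodule.mem_span_pair.2 ⟨m, n, RingOfIntegers.ext ?_⟩
  simp only [zsmul_eq_mul, mul_one]
  push_cast [coe_halfOneAdd]
  exact h.symm

/-- The integral basis `1, (1 + √-p) / 2` of `ℚ(√-p)`. -/
noncomputable def halfBasis : Module.Basis (Fin 2) ℤ (𝓞 K) :=
  Module.Basis.mk (linearIndependent_one_halfOneAdd hα hp4) (span_one_halfOneAdd hα hgen hp4)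

theorem halfBasis_zero : halfBasis hα hgen hp4 0 = 1 := by simp [halfBasis]

theorem halfBasis_one : halfBasis hα hgen hp4 1 = halfOneAdd hα hp4 := by simp [halfBasis]

theorem halfBasis_one_mul_self : halfBasis hα hgen hp4 1 * halfBasis hα hgen hp4 1 =
    algebraMap ℤ (𝓞 K) (-(((p + 1) / 4 : ℕ) : ℤ)) + (1 : ℤ) • halfBasis hα hgen hp4 1 := by
  rw [halfBasis_one, halfOneAdd_mul_self]
  simp only [map_neg, map_natCast, one_smul]

include hα hgen hp4 in
theorem discr_eq_neg : NumberField.discr K = -p := by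
  have htr := trace_quadratic _ (halfBasis_zero hα hgen hp4) (halfBasis_one_mul_self hα hgen hp4)
  have h00 := htr 1 0
  have h01 := htr 0 1
  have h11 := htr (-(((p + 1) / 4 : ℕ) : ℤ)) 1
  rw [← halfBasis_one_mul_self] at h11
  simp only [map_one, zero_smul, add_zero, map_zero, one_smul, zero_add] at h00 h01 h11
  rw [← NumberField.discr_eq_discr K (halfBasis hα hgen hp4), Algebra.discr_def,
    Matrix.det_fin_two]
  simp only [Algebra.traceMatrix_apply, Algebra.traceForm_apply, halfBasis_zero, mul_one, one_mul]
  rw [h11]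
  rw [h00, h01]
  have : p = 4 * ((p + 1) / 4) - 1 := by omega
  omega

include hα hgen hp4 in
theorem units_eq_one_or_neg_one (hp3 : 3 < p) (u : (𝓞 K)ˣ) : u = 1 ∨ u = -1 := by
  have hu := u.isUnit.map (Algebra.norm ℤ)
  have hx := eq_repr_quadratic _ (halfBasis_zero hα hgen hp4) (u : 𝓞 K)
  set m := (halfBasis hα hgen hp4).repr (u : 𝓞 K) 0
  set n := (halfBasis hα hgen hp4).repr (u : 𝓞 K) 1
  rw [hx, norm_quadratic _ (halfBasis_zero hα hgen hp4) (halfBasis_one_mul_self hα hgen hp4),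
    Int.isUnit_iff] at hu
  have hp : (p : ℤ) = 4 * (((p + 1) / 4 : ℕ) : ℤ) - 1 := by omega
  set c : ℤ := (((p + 1) / 4 : ℕ) : ℤ)
  have hp7 : (7 : ℤ) ≤ p := by omega
  have hn0 : n = 0 := by
    by_contra hn
    have : 1 ≤ n ^ 2 := by have := sq_pos_of_ne_zero hn; omega
    rcases hu with hu | hu <;> nlinarith [sq_nonneg (2 * m + n)]
  rw [hn0] at hu hx
  have hm : m = 1 ∨ m = -1 := by
    rcases hu with hu | hu
    · exact eq_or_eq_neg_of_sq_eq_sq m 1 (by linarith)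
    · nlinarith
  rcases hm with hm | hm <;> rw [hm] at hx
  · left; ext; rw [hx]; simp
  · right; ext; rw [hx]; simp

include hα hgen hp4 in
theorem torsionOrder_eq_two (hp3 : 3 < p) : Units.torsionOrder K = 2 := by
  have h1 : Units.torsionOrder K ≤ 2 := by
    have h4 : (Set.univ : Set (Units.torsion K)) ⊆ {1, ⟨-1, neg_one_mem_torsion⟩} := by
      rintro ⟨u, hu⟩ -
      rcases units_eq_one_or_neg_one hα hgen hp4 hp3 u with rfl | rfl
      · left; rfl
      · right; rfl
    rw [Units.torsionOrder, ← Set.ncard_univ]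
    exact (Set.ncard_le_ncard h4).trans ((Set.ncard_insert_le _ _).trans (by simp))
  have h2 := Units.even_torsionOrder K
  have h3 := Units.torsionOrder_pos K
  obtain ⟨k, hk⟩ := h2
  omega

include hα in
theorem nrRealPlaces_eq_zero : InfinitePlace.nrRealPlaces K = 0 := by
  classical
  rw [InfinitePlace.nrRealPlaces, Fintype.card_eq_zero_iff]
  refine ⟨fun ⟨w, hw⟩ => ?_⟩
  have h1 := congrArg (InfinitePlace.embedding_of_isReal hw) hα
  rw [map_pow, map_neg, map_natCast] at h1
  have h2 : (0 : ℝ) < p := by exact_mod_cast (Fact.out : p.Prime).pos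
  nlinarith [sq_nonneg (InfinitePlace.embedding_of_isReal hw α)]

include hα hgen in
theorem nrComplexPlaces_eq_one : InfinitePlace.nrComplexPlaces K = 1 := by
  have h1 := InfinitePlace.card_add_two_mul_card_eq_rank K
  rw [nrRealPlaces_eq_zero hα, Module.finrank_eq_card_basis (sqrtBasis hα hgen),
    Fintype.card_fin] at h1
  omega

include hα hgen in
theorem regulator_eq_one : Units.regulator K = 1 := by
  have : Units.rank K = 0 := by
    rw [Units.rank, InfinitePlace.card_eq_nrRealPlaces_add_nrComplexPlaces,
      nrRealPlaces_eq_zero hα, nrComplexPlaces_eq_one hα hgen]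
  have he : IsEmpty (Fin (Units.rank K)) := by rw [this]; infer_instance
  have he2 := (Units.equivFinRank K).symm.isEmpty
  classical
  rw [Units.regulator_eq_det', Matrix.det_isEmpty, abs_one]

include hα hgen hp4 in
theorem dedekindZeta_residue_eq (hp3 : 3 < p) :
    dedekindZeta_residue K = Real.pi * classNumber K / Real.sqrt p := by
  rw [dedekindZeta_residue_def, nrRealPlaces_eq_zero hα, nrComplexPlaces_eq_one hα hgen,
    regulator_eq_one hα hgen, torsionOrder_eq_two hα hgen hp4 hp3, discr_eq_neg hα hgen hp4]
  simp
  field_simp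

end ImaginaryQuadratic

theorem card_ideal_absNorm_eq_prime {S : Type*} [CommRing S] [IsDedekindDomain S]
    [Module.Free ℤ S] [Module.Finite ℤ S]
    (b : Module.Basis (Fin 2) ℤ S) {c d : ℤ} (h0 : b 0 = 1)
    (h1 : b 1 * b 1 = algebraMap ℤ S c + d • b 1) (q : ℕ) [Fact q.Prime] :
    Nat.card {I : Ideal S // Ideal.absNorm I = q} =
      Nat.card {r : ZMod q // r * r = (c : ZMod q) + d * r} := by
  have hex : ∀ r : {r : ZMod q // r * r = (c : ZMod q) + d * r}, ∃ φ : S →+* ZMod q, φ (b 1) = r :=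
    fun r => exists_ringHom_quadratic b h0 h1 (Int.castRingHom (ZMod q)) (by simpa using r.2)
  choose φ hφ using hex
  have hnorm : ∀ ψ : S →+* ZMod q, Ideal.absNorm (RingHom.ker ψ) = q := by
    intro ψ
    rw [Ideal.absNorm_apply, Submodule.cardQuot_apply,
      Nat.card_congr (RingHom.quotientKerEquivOfSurjective (ZMod.ringHom_surjective ψ)).toEquiv,
      Nat.card_zmod]
  symm
  refine Nat.card_eq_of_bijective (fun r => ⟨RingHom.ker (φ r), hnorm _⟩) ⟨?_, ?_⟩
  · intro r r' h
    have h2 : RingHom.ker (φ r) = RingHom.ker (φ r') := congrArg Subtype.val h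
    have h3 : b 1 - ((r : ZMod q).val : S) ∈ RingHom.ker (φ r) := by
      simp [RingHom.mem_ker, hφ]
    rw [h2] at h3
    rw [RingHom.mem_ker, map_sub, hφ, map_natCast, ZMod.natCast_zmod_val] at h3
    exact Subtype.ext (sub_eq_zero.1 h3).symm
  · rintro ⟨I, hI⟩
    have hcard : Nat.card (S ⧸ I) = q := by
      rw [← hI, Ideal.absNorm_apply, Submodule.cardQuot_apply]
    have hfin : Finite (S ⧸ I) := Nat.finite_of_card_ne_zero (by
      rw [hcard]; exact (Fact.out : q.Prime).ne_zero)
    have := Fintype.ofFinite (S ⧸ I)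
    let e := ZMod.ringEquivOfPrime (S ⧸ I) (Fact.out : q.Prime)
      (by rw [← Nat.card_eq_fintype_card, hcard])
    let ψ : S →+* ZMod q := (e.symm : S ⧸ I →+* ZMod q).comp (Ideal.Quotient.mk I)
    have hψ : RingHom.ker ψ = I := by
      ext x
      simp [ψ, RingHom.mem_ker, Ideal.Quotient.eq_zero_iff_mem]
    have hr : ψ (b 1) * ψ (b 1) = (c : ZMod q) + d * ψ (b 1) := by
      rw [← map_mul, h1]
      simp
    refine ⟨⟨ψ (b 1), hr⟩, Subtype.ext ?_⟩
    dsimp only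
    rw [← hψ]
    congr 1
    exact ringHom_ext_quadratic b h0 (RingHom.ext_int _ _) (hφ _)

section Ideals

variable {S : Type*} [CommRing S] [IsDedekindDomain S] [Module.Free ℤ S] [Module.Finite ℤ S]

theorem isCoprime_of_absNorm_coprime {I J : Ideal S}
    (h : (Ideal.absNorm I).Coprime (Ideal.absNorm J)) : IsCoprime I J := by
  rw [Ideal.isCoprime_iff_exists]
  have h1 : IsCoprime ((Ideal.absNorm I : ℕ) : S) (Ideal.absNorm J : S) := by
    have := (Nat.isCoprime_iff_coprime.2 h).map (Int.castRingHom S)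
    simpa using this
  obtain ⟨u, v, huv⟩ := h1
  exact ⟨u * Ideal.absNorm I, I.mul_mem_left _ (Ideal.absNorm_mem I), v * Ideal.absNorm J,
    J.mul_mem_left _ (Ideal.absNorm_mem J), huv⟩

theorem absNorm_sup_span_dvd (L : Ideal S) {m n : ℕ} (hmn : m.Coprime n)
    (hL : Ideal.absNorm L = m * n) : Ideal.absNorm (L ⊔ Ideal.span {(m : S)}) ∣ m := by
  have h1 : Ideal.absNorm (L ⊔ Ideal.span {(m : S)}) ∣ m * n :=
    hL ▸ Ideal.absNorm_dvd_absNorm_of_le le_sup_left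
  have h2 : Ideal.absNorm (L ⊔ Ideal.span {(m : S)}) ∣ m ^ Module.finrank ℤ S := by
    have := Ideal.absNorm_dvd_absNorm_of_le (le_sup_right : Ideal.span {(m : S)} ≤ L ⊔ _)
    have h3 : Ideal.absNorm (Ideal.span {(m : S)}) = m ^ Module.finrank ℤ S := by
      rw [Ideal.absNorm_span_natCast]
    rwa [h3] at this
  exact (Nat.Coprime.coprime_dvd_left h2 (hmn.pow_left _)).dvd_of_dvd_mul_right h1

theorem card_absNorm_mul {m n : ℕ} (hmn : m.Coprime n) (hm : m ≠ 0) (hn : n ≠ 0) :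
    Nat.card {I : Ideal S // Ideal.absNorm I = m * n} =
      Nat.card {I : Ideal S // Ideal.absNorm I = m} *
        Nat.card {I : Ideal S // Ideal.absNorm I = n} := by
  rw [← Nat.card_prod]
  symm
  refine Nat.card_eq_of_bijective (fun x => ⟨x.1.1 * x.2.1, by rw [map_mul, x.1.2, x.2.2]⟩)
    ⟨?_, ?_⟩
  · rintro ⟨⟨I, hI⟩, ⟨J, hJ⟩⟩ ⟨⟨I', hI'⟩, ⟨J', hJ'⟩⟩ h
    have h : I * J = I' * J' := congrArg Subtype.val h
    have key : ∀ {A B A' B' : Ideal S}, (Ideal.absNorm A).Coprime (Ideal.absNorm B') →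
        A * B = A' * B' → A ∣ A' := fun hc h =>
      (isCoprime_of_absNorm_coprime hc).dvd_of_dvd_mul_right (h ▸ dvd_mul_right _ _)
    have hII : I = I' := associated_iff_eq.1 (associated_of_dvd_dvd
      (key (by rwa [hI, hJ']) h) (key (by rwa [hI', hJ]) h.symm))
    have hJJ : J = J' := by
      rw [mul_comm I, mul_comm I'] at h
      exact associated_iff_eq.1 (associated_of_dvd_dvd
        (key (by rw [hJ, hI']; exact hmn.symm) h) (key (by rw [hJ', hI]; exact hmn.symm) h.symm))
    subst hII hJJ
    rfl
  · rintro ⟨L, hL⟩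
    have hLmem : ((m : S) * n) ∈ L := by
      have := Ideal.absNorm_mem L
      rwa [hL, Nat.cast_mul] at this
    have hprod : (L ⊔ Ideal.span {(m : S)}) * (L ⊔ Ideal.span {(n : S)}) = L := by
      apply le_antisymm
      · rw [Ideal.sup_mul, Ideal.mul_sup, Ideal.mul_sup, Ideal.span_singleton_mul_span_singleton]
        refine sup_le (sup_le Ideal.mul_le_left Ideal.mul_le_left)
          (sup_le Ideal.mul_le_right ?_)
        rwa [Ideal.span_singleton_le_iff_mem]
      · intro x hx
        have h1 : IsCoprime (m : S) (n : S) := by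
          have := (Nat.isCoprime_iff_coprime.2 hmn).map (Int.castRingHom S)
          simpa using this
        obtain ⟨u, v, huv⟩ := h1
        have h2 : x = m * (u * x) + (v * x) * n := by linear_combination -x * huv
        rw [h2]
        refine add_mem ?_ ?_
        · exact Ideal.mul_mem_mul ((le_sup_right : _ ≤ L ⊔ _) (Ideal.mem_span_singleton_self _))
            ((le_sup_left : L ≤ _) (L.mul_mem_left _ hx))
        · exact Ideal.mul_mem_mul ((le_sup_left : L ≤ _) (L.mul_mem_left _ hx))
            ((le_sup_right : _ ≤ L ⊔ _) (Ideal.mem_span_singleton_self _))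
    have hN := congrArg Ideal.absNorm hprod
    rw [map_mul, hL] at hN
    have hd1 := absNorm_sup_span_dvd L hmn hL
    have hd2 := absNorm_sup_span_dvd L hmn.symm (by rw [hL, mul_comm])
    have e1 := Nat.le_of_dvd (Nat.pos_of_ne_zero hm) hd1
    have e2 := Nat.le_of_dvd (Nat.pos_of_ne_zero hn) hd2
    have hm0 := Nat.pos_of_ne_zero hm
    have hn0 := Nat.pos_of_ne_zero hn
    have hN1 : Ideal.absNorm (L ⊔ Ideal.span {(m : S)}) = m := by nlinarith
    have hN2 : Ideal.absNorm (L ⊔ Ideal.span {(n : S)}) = n := by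
      rw [hN1] at hN; exact Nat.eq_of_mul_eq_mul_left hm0 hN
    exact ⟨⟨⟨_, hN1⟩, ⟨_, hN2⟩⟩, Subtype.ext hprod⟩

theorem dvd_span_pow_of_absNorm {q k : ℕ} {I : Ideal S} (hI : Ideal.absNorm I = q ^ k) :
    I ∣ Ideal.span {(q : S)} ^ k := by
  rw [Ideal.dvd_iff_le, Ideal.span_singleton_pow, Ideal.span_singleton_le_iff_mem]
  have := Ideal.absNorm_mem I
  rwa [hI, Nat.cast_pow] at this

theorem absNorm_span_of_finrank_two (h2 : Module.finrank ℤ S = 2) (q : ℕ) :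
    Ideal.absNorm (Ideal.span {(q : S)}) = q ^ 2 := by
  rw [Ideal.absNorm_span_natCast, h2]

theorem prime_span_of_card_eq_zero (h2 : Module.finrank ℤ S = 2) {q : ℕ} (hq : q.Prime)
    (h : ∀ I : Ideal S, Ideal.absNorm I ≠ q) : Prime (Ideal.span {(q : S)}) := by
  have hQ := absNorm_span_of_finrank_two h2 q
  rw [← irreducible_iff_prime]
  constructor
  · intro hu
    rw [Ideal.isUnit_iff.1 hu, Ideal.absNorm_top] at hQ
    have := hq.one_lt
    nlinarith
  · intro A B hAB
    have h3 : Ideal.absNorm A * Ideal.absNorm B = q ^ 2 := by rw [← map_mul, ← hAB, hQ]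
    obtain ⟨i, hi, hA⟩ := (Nat.dvd_prime_pow hq).1 (Dvd.intro _ h3)
    rw [Ideal.isUnit_iff, Ideal.isUnit_iff, ← Ideal.absNorm_eq_one_iff, ← Ideal.absNorm_eq_one_iff]
    interval_cases i
    · left; simpa using hA
    · exact absurd (by simpa using hA) (h A)
    · right
      rw [hA] at h3
      exact Nat.eq_of_mul_eq_mul_left (pow_pos hq.pos 2) (by rw [h3, mul_one])

theorem card_absNorm_eq_prime_pow_inert (h2 : Module.finrank ℤ S = 2) {q : ℕ} (hq : q.Prime)
    (h : ∀ I : Ideal S, Ideal.absNorm I ≠ q) (k : ℕ) :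
    Nat.card {I : Ideal S // Ideal.absNorm I = q ^ k} = if Even k then 1 else 0 := by
  have hQ := absNorm_span_of_finrank_two h2 q
  have hI : ∀ I : Ideal S, Ideal.absNorm I = q ^ k →
      ∃ j, k = 2 * j ∧ I = Ideal.span {(q : S)} ^ j := by
    intro I hI
    obtain ⟨j, -, hj⟩ := (dvd_prime_pow (prime_span_of_card_eq_zero h2 hq h) k).1
      (dvd_span_pow_of_absNorm hI)
    have hj := associated_iff_eq.1 hj
    rw [hj, map_pow, hQ, ← pow_mul] at hI
    exact ⟨j, (Nat.pow_right_injective hq.two_le hI).symm, hj⟩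
  split_ifs with hk
  · obtain ⟨j, rfl⟩ := hk
    rw [Nat.card_eq_one_iff_unique]
    refine ⟨⟨?_⟩, ⟨⟨Ideal.span {(q : S)} ^ j, by rw [map_pow, hQ, ← pow_mul, two_mul]⟩⟩⟩
    rintro ⟨I, h3⟩ ⟨J, h4⟩
    obtain ⟨i, hi, rfl⟩ := hI I h3
    obtain ⟨i', hi', rfl⟩ := hI J h4
    obtain rfl : i = i' := by omega
    rfl
  · rw [Nat.card_eq_zero]
    left
    refine ⟨fun ⟨I, h3⟩ => hk ?_⟩
    obtain ⟨j, hj, -⟩ := hI I h3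
    exact hj ▸ even_two_mul j

theorem prime_of_absNorm_eq_prime {q : ℕ} (hq : q.Prime) {P : Ideal S}
    (hP : Ideal.absNorm P = q) : Prime P := by
  rw [← irreducible_iff_prime]
  exact Ideal.irreducible_of_irreducible_absNorm (hP ▸ hq)

theorem dvd_span_of_absNorm {q : ℕ} {P : Ideal S} (hP : Ideal.absNorm P = q) :
    P ∣ Ideal.span {(q : S)} := by
  have := dvd_span_pow_of_absNorm (q := q) (k := 1) (by rwa [pow_one])
  rwa [pow_one] at this

theorem card_absNorm_eq_prime_pow_ramified (h2 : Module.finrank ℤ S = 2) {q : ℕ} (hq : q.Prime)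
    {P : Ideal S} (hP : Ideal.absNorm P = q) (h : ∀ I : Ideal S, Ideal.absNorm I = q → I = P)
    (k : ℕ) : Nat.card {I : Ideal S // Ideal.absNorm I = q ^ k} = 1 := by
  have hQ := absNorm_span_of_finrank_two h2 q
  have hsq : Ideal.span {(q : S)} = P ^ 2 := by
    obtain ⟨J, hJ⟩ := dvd_span_of_absNorm hP
    rw [hJ, map_mul, hP, sq] at hQ
    rw [hJ, h J (Nat.eq_of_mul_eq_mul_left hq.pos hQ), sq]
  have hI : ∀ I : Ideal S, Ideal.absNorm I = q ^ k → I = P ^ k := by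
    intro I hI
    have h3 := dvd_span_pow_of_absNorm hI
    rw [hsq, ← pow_mul] at h3
    obtain ⟨j, -, hj⟩ := (dvd_prime_pow (prime_of_absNorm_eq_prime hq hP) _).1 h3
    have hj := associated_iff_eq.1 hj
    rw [hj, map_pow, hP] at hI
    rw [hj, Nat.pow_right_injective hq.two_le hI]
  rw [Nat.card_eq_one_iff_unique]
  exact ⟨⟨fun I J => Subtype.ext ((hI I I.2).trans (hI J J.2).symm)⟩, ⟨⟨P ^ k, by rw [map_pow, hP]⟩⟩⟩

theorem card_absNorm_eq_prime_pow_split (h2 : Module.finrank ℤ S = 2) {q : ℕ} (hq : q.Prime)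
    {P P' : Ideal S} (hP : Ideal.absNorm P = q) (hP' : Ideal.absNorm P' = q) (hne : P ≠ P')
    (k : ℕ) : Nat.card {I : Ideal S // Ideal.absNorm I = q ^ k} = k + 1 := by
  have hQ := absNorm_span_of_finrank_two h2 q
  have hPp := prime_of_absNorm_eq_prime hq hP
  have hPp' := prime_of_absNorm_eq_prime hq hP'
  have hnd : ¬ P ∣ P' := fun hd => hne (associated_iff_eq.1 (hPp.associated_of_dvd hPp' hd))
  have hmul : Ideal.span {(q : S)} = P * P' := by
    obtain ⟨J, hJ⟩ := dvd_span_of_absNorm hP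
    have h3 := dvd_span_of_absNorm hP'
    rw [hJ] at h3
    rw [hJ, map_mul, hP, sq] at hQ
    have hJn := Nat.eq_of_mul_eq_mul_left hq.pos hQ
    have h4 : P' ∣ J := (hPp'.dvd_or_dvd h3).resolve_left fun hd =>
      hne (associated_iff_eq.1 (hPp'.associated_of_dvd hPp hd)).symm
    rw [hJ, associated_iff_eq.1 (hPp'.associated_of_dvd (prime_of_absNorm_eq_prime hq hJn) h4)]
  rw [← Nat.card_eq_fintype_card (α := Fin (k + 1)) |>.trans (Fintype.card_fin _)]
  symm
  refine Nat.card_eq_of_bijective (fun i => ⟨P ^ (i : ℕ) * P' ^ (k - i), ?_⟩) ⟨?_, ?_⟩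
  · rw [map_mul, map_pow, map_pow, hP, hP', ← pow_add]
    congr 1
    omega
  · have key : ∀ i j : Fin (k + 1), P ^ (i : ℕ) * P' ^ (k - i) = P ^ (j : ℕ) * P' ^ (k - j) →
        i ≤ j := by
      intro i j h
      by_contra hij
      have h3 : P ^ (i : ℕ) ∣ P ^ (j : ℕ) * P' ^ (k - j) := h ▸ dvd_mul_right _ _
      have h4 : P ^ (i : ℕ) ∣ P ^ (j : ℕ) := (hPp.pow_dvd_of_dvd_mul_right _
        (fun hd => hnd (hPp.dvd_of_dvd_pow hd)) h3)
      exact hij ((pow_dvd_pow_iff hPp.ne_zero hPp.not_isUnit).1 h4)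
    intro i j h
    have h := congrArg Subtype.val h
    exact le_antisymm (key i j h) (key j i h.symm)
  · rintro ⟨I, hI⟩
    have h3 := dvd_span_pow_of_absNorm hI
    rw [hmul, mul_pow] at h3
    obtain ⟨A, B, hA, hB, rfl⟩ := exists_dvd_and_dvd_of_dvd_mul h3
    obtain ⟨i, hi, hAi⟩ := (dvd_prime_pow hPp _).1 hA
    obtain ⟨j, hj, hBj⟩ := (dvd_prime_pow hPp' _).1 hB
    rw [associated_iff_eq.1 hAi, associated_iff_eq.1 hBj, map_mul, map_pow, map_pow, hP, hP',
      ← pow_add] at hI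
    have hij := Nat.pow_right_injective hq.two_le hI
    refine ⟨⟨i, by omega⟩, Subtype.ext ?_⟩
    dsimp only
    rw [associated_iff_eq.1 hAi, associated_iff_eq.1 hBj, ← hij, Nat.add_sub_cancel_left]

end Ideals

theorem legendreSym_neg_eq {p q : ℕ} [Fact p.Prime] [Fact q.Prime] (hp4 : p % 4 = 3) (hq : q ≠ 2) :
    legendreSym q (-p : ℤ) = legendreSym p q := by
  have hqo : q % 2 = 1 := (Fact.out : q.Prime).eq_two_or_odd.resolve_left hq
  rw [← neg_one_mul, legendreSym.mul, legendreSym.at_neg_one hq]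
  rcases (show q % 4 = 1 ∨ q % 4 = 3 by omega) with h | h
  · rw [ZMod.χ₄_nat_one_mod_four h, one_mul,
      legendreSym.quadratic_reciprocity_one_mod_four h (by omega)]
  · rw [ZMod.χ₄_nat_three_mod_four h, legendreSym.quadratic_reciprocity_three_mod_four hp4 h]
    ring

theorem card_roots_zmod_two :
    Nat.card {r : ZMod 2 // r * r = -1 + ((1 : ℤ) : ZMod 2) * r} = 0 ∧
      Nat.card {r : ZMod 2 // r * r = -0 + ((1 : ℤ) : ZMod 2) * r} = 2 := by
  rw [Nat.card_eq_fintype_card, Nat.card_eq_fintype_card]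
  decide

theorem card_roots_eq_one_add_legendreSym {p q : ℕ} [Fact p.Prime] [Fact q.Prime]
    (hp4 : p % 4 = 3) :
    (Nat.card {r : ZMod q // r * r = ((-(((p + 1) / 4 : ℕ) : ℤ) : ℤ) : ZMod q) +
      ((1 : ℤ) : ZMod q) * r} : ℤ) = legendreSym p q + 1 := by
  rcases eq_or_ne q 2 with rfl | hq
  · rw [Nat.cast_ofNat, legendreSym.at_two (by omega), ZMod.χ₈_nat_eq_if_mod_eight]
    rcases (show p % 8 = 3 ∨ p % 8 = 7 by omega) with h | h
    · have h1 : ((((p + 1) / 4 : ℕ) : ℤ) : ZMod 2) = 1 := by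
        rw [Int.cast_natCast, ← ZMod.natCast_mod, show (p + 1) / 4 % 2 = 1 by omega, Nat.cast_one]
      rw [Int.cast_neg, h1, if_neg (by omega), if_neg (by omega),
        card_roots_zmod_two.1]
      norm_num
    · have h1 : ((((p + 1) / 4 : ℕ) : ℤ) : ZMod 2) = 0 := by
        rw [Int.cast_natCast, ← ZMod.natCast_mod, show (p + 1) / 4 % 2 = 0 by omega, Nat.cast_zero]
      rw [Int.cast_neg, h1, if_neg (by omega), if_pos (by omega),
        card_roots_zmod_two.2]
      norm_num
  · rw [← legendreSym_neg_eq hp4 hq, ← legendreSym.card_sqrts q hq, Nat.cast_inj]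
    rw [Set.toFinset_card, ← Nat.card_eq_fintype_card]
    have h2 : (2 : ZMod q) ≠ 0 := Ring.two_ne_zero (by rwa [ZMod.ringChar_zmod_n])
    have hc : (4 : ZMod q) * (((p + 1) / 4 : ℕ) : ZMod q) = p + 1 := by
      have : 4 * ((p + 1) / 4) = p + 1 := by omega
      exact_mod_cast congrArg (Nat.cast : ℕ → ZMod q) this
    have hiff : ∀ r : ZMod q, r * r = ((-(((p + 1) / 4 : ℕ) : ℤ) : ℤ) : ZMod q) +
        ((1 : ℤ) : ZMod q) * r ↔ (2 * r - 1) ^ 2 = ((-p : ℤ) : ZMod q) := by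
      intro r
      rw [Int.cast_neg, Int.cast_neg, Int.cast_natCast, Int.cast_natCast, Int.cast_one]
      constructor
      · intro h; linear_combination 4 * h - hc
      · intro h
        refine mul_left_cancel₀ (mul_ne_zero h2 h2) ?_
        linear_combination h + hc
    refine Nat.card_eq_of_bijective (fun r => ⟨2 * r.1 - 1, (hiff r.1).1 r.2⟩) ⟨?_, ?_⟩
    · intro r s h
      have h := congrArg Subtype.val h
      exact Subtype.ext (mul_left_cancel₀ h2 (sub_left_injective h))
    · rintro ⟨y, hy⟩
      have hy2 : 2 * ((y + 1) / 2) - 1 = y := by field_simp; ring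
      exact ⟨⟨(y + 1) / 2, (hiff _).2 (by rw [hy2]; exact hy)⟩, Subtype.ext hy2⟩

theorem card_absNorm_eq_prime_pow {S : Type*} [CommRing S] [IsDedekindDomain S] [Module.Free ℤ S]
    [Module.Finite ℤ S] [CharZero S] (h2 : Module.finrank ℤ S = 2) {q : ℕ} (hq : q.Prime) {x : ℤ}
    (hx : x = 0 ∨ x = 1 ∨ x = -1)
    (h : (Nat.card {I : Ideal S // Ideal.absNorm I = q} : ℤ) = x + 1) (k : ℕ) :
    (Nat.card {I : Ideal S // Ideal.absNorm I = q ^ k} : ℤ) =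
      ∑ i ∈ Finset.range (k + 1), x ^ i := by
  rcases hx with rfl | rfl | rfl
  · have h3 : Nat.card {I : Ideal S // Ideal.absNorm I = q} = 1 := by omega
    obtain ⟨hs, ⟨P, hP⟩⟩ := Nat.card_eq_one_iff_unique.1 h3
    rw [card_absNorm_eq_prime_pow_ramified h2 hq hP fun I hI =>
      congrArg Subtype.val (Subsingleton.elim (⟨I, hI⟩ : {I : Ideal S // Ideal.absNorm I = q}) ⟨P, hP⟩)]
    rw [Finset.sum_range_succ', Finset.sum_eq_zero (by simp)]
    simp
  · have h3 : Nat.card {I : Ideal S // Ideal.absNorm I = q} = 2 := by omega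
    obtain ⟨⟨P, hP⟩, ⟨P', hP'⟩, hne, -⟩ := Nat.card_eq_two_iff.1 h3
    rw [card_absNorm_eq_prime_pow_split h2 hq hP hP' fun h => hne (Subtype.ext h)]
    simp
  · have h3 : Nat.card {I : Ideal S // Ideal.absNorm I = q} = 0 := by omega
    have hne : ∀ I : Ideal S, Ideal.absNorm I ≠ q := by
      intro I hI
      rcases Nat.card_eq_zero.1 h3 with h4 | h4
      · exact h4.false ⟨I, hI⟩
      · refine h4.not_finite ?_
        exact (Ideal.finite_setOfPred_absNorm_eq q).to_subtype
    rw [card_absNorm_eq_prime_pow_inert h2 hq hne, neg_one_geom_sum]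
    by_cases hk : Even k <;> simp [hk, Nat.even_add_one]

/-- The quadratic character modulo `p`, as a complex arithmetic function. -/
noncomputable def quadCharFun (p : ℕ) [Fact p.Prime] : ArithmeticFunction ℂ :=
  ⟨fun n => (quadraticChar (ZMod p) n : ℂ), by simp⟩

theorem isMultiplicative_quadCharFun (p : ℕ) [Fact p.Prime] : (quadCharFun p).IsMultiplicative :=
  ⟨by simp [quadCharFun], fun {m n} _ => by simp [quadCharFun, -quadraticChar_apply]⟩

/-- The number of ideals of given nonzero norm, as an arithmetic function. -/
noncomputable def idealCount (S : Type*) [CommRing S] [IsDedekindDomain S] [Module.Free ℤ S]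
    [Module.Finite ℤ S] : ArithmeticFunction ℂ :=
  ⟨fun n => if n = 0 then 0 else (Nat.card {I : Ideal S // Ideal.absNorm I = n} : ℂ), by simp⟩

theorem isMultiplicative_idealCount (S : Type*) [CommRing S] [IsDedekindDomain S] [Module.Free ℤ S]
    [Module.Finite ℤ S] : (idealCount S).IsMultiplicative := by
  rw [ArithmeticFunction.IsMultiplicative.iff_ne_zero]
  refine ⟨?_, fun {m n} hm hn hmn => ?_⟩
  · simp [idealCount, Ideal.absNorm_eq_one_iff]
  · simp [idealCount, hm, hn, card_absNorm_mul hmn hm hn]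

section ClassNumber

variable {p : ℕ} [Fact p.Prime] {K : Type*} [Field K] [NumberField K] {α : K}
  (hα : α ^ 2 = -(p : K)) (hgen : Algebra.adjoin ℚ {α} = ⊤) (hp4 : p % 4 = 3)

include hα hgen hp4 in
theorem idealCount_eq_zeta_mul :
    idealCount (𝓞 K) = (ArithmeticFunction.zeta : ArithmeticFunction ℂ) * quadCharFun p := by
  rw [(isMultiplicative_idealCount _).eq_iff_eq_on_prime_powers _ _
    (ArithmeticFunction.isMultiplicative_zeta.natCast.mul (isMultiplicative_quadCharFun p))]
  intro q k hq
  have : Fact q.Prime := ⟨hq⟩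
  have h2 : Module.finrank ℤ (𝓞 K) = 2 := by
    rw [Module.finrank_eq_card_basis (halfBasis hα hgen hp4), Fintype.card_fin]
  have h3 := card_ideal_absNorm_eq_prime _ (halfBasis_zero hα hgen hp4)
    (halfBasis_one_mul_self hα hgen hp4) q
  have h4 := card_roots_eq_one_add_legendreSym (q := q) hp4
  rw [← h3] at h4
  have hx : legendreSym p q = 0 ∨ legendreSym p q = 1 ∨ legendreSym p q = -1 := by
    by_cases h : ((q : ℤ) : ZMod p) = 0
    · exact Or.inl ((legendreSym.eq_zero_iff p _).2 h)
    · exact Or.inr (legendreSym.eq_one_or_neg_one p h)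
  have h5 := card_absNorm_eq_prime_pow h2 hq hx h4 k
  rw [ArithmeticFunction.coe_zeta_mul_apply, Nat.sum_divisors_prime_pow hq]
  have h6 : ∀ i, quadCharFun p (q ^ i) = (((legendreSym p q) ^ i : ℤ) : ℂ) := by
    intro i
    simp [quadCharFun, legendreSym, -quadraticChar_apply]
  rw [Finset.sum_congr rfl fun i _ => h6 i, ← Int.cast_sum, ← h5, Int.cast_natCast]
  simp [idealCount, hq.ne_zero]

include hα hgen hp4 in
theorem dedekindZeta_eq_mul {s : ℂ} (hs : 1 < s.re) : dedekindZeta K s =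
    riemannZeta s * LSeries (fun n : ℕ => (quadraticChar (ZMod p) n : ℂ)) s := by
  rw [← ArithmeticFunction.LSeries_zeta_eq_riemannZeta hs]
  have h1 := ArithmeticFunction.LSeries_mul' (f := (ArithmeticFunction.zeta : ArithmeticFunction ℂ))
    (g := quadCharFun p) (s := s)
    (by simpa using ArithmeticFunction.LSeriesSummable_zeta_iff.2 hs)
    (ZMod.LSeriesSummable_of_one_lt_re (fun c : ZMod p => (quadraticChar (ZMod p) c : ℂ)) hs)
  rw [← idealCount_eq_zeta_mul hα hgen hp4] at h1
  have h2 : dedekindZeta K s = LSeries (idealCount (𝓞 K)) s := by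
    refine LSeries_congr (fun {n} hn => ?_) s
    simp [idealCount, hn]
  rw [h2, h1]
  simp [quadCharFun]

include hα hgen hp4 in
/-- The analytic class number formula for `ℚ(√-p)`, in closed form. -/
theorem mul_classNumber_eq_neg_sum (hp3 : 3 < p) :
    (p : ℤ) * classNumber K = -∑ k ∈ Finset.range p, (k : ℤ) * legendreSym p k := by
  have hL := tendsto_LSeries_quadraticChar p hp4
  have hζ : Filter.Tendsto (fun s : ℝ => ((s : ℂ) - 1) * riemannZeta s)
      (nhdsWithin 1 (Set.Ioi 1)) (nhds 1) := by
    refine riemannZeta_residue_one.comp (tendsto_nhdsWithin_iff.2 ⟨?_, ?_⟩)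
    · have := (Complex.continuous_ofReal.tendsto 1).mono_left
        (nhdsWithin_le_nhds (s := Set.Ioi (1 : ℝ)))
      simpa using this
    · filter_upwards [self_mem_nhdsWithin] with s hs
      have : s ≠ 1 := (Set.mem_Ioi.1 hs).ne'
      simpa using this
  have hK := tendsto_sub_one_mul_dedekindZeta_nhdsGT K
  have h1 := tendsto_nhds_unique (hK.congr' (by
    filter_upwards [self_mem_nhdsWithin] with s hs
    rw [dedekindZeta_eq_mul hα hgen hp4 (by simpa using hs), ← mul_assoc])) (hζ.mul hL)
  rw [dedekindZeta_residue_eq hα hgen hp4 hp3] at h1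
  have hp : (p : ℂ) ≠ 0 := by exact_mod_cast (Fact.out : p.Prime).ne_zero
  have hpi : (Real.pi : ℂ) ≠ 0 := by exact_mod_cast Real.pi_ne_zero
  have hsq : (Real.sqrt p : ℂ) ≠ 0 := by
    have : Real.sqrt p ≠ 0 := (Real.sqrt_pos.2 (by exact_mod_cast (Fact.out : p.Prime).pos)).ne'
    exact_mod_cast this
  have h2 : (((p : ℤ) * classNumber K : ℤ) : ℂ) =
      ((-∑ k ∈ Finset.range p, (k : ℤ) * legendreSym p k : ℤ) : ℂ) := by
    rw [Int.cast_neg]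
    generalize ((∑ k ∈ Finset.range p, (k : ℤ) * legendreSym p k : ℤ) : ℂ) = T at h1 ⊢
    push_cast at h1 ⊢
    rw [one_mul, div_eq_div_iff hsq (mul_ne_zero hp hsq)] at h1
    refine mul_left_cancel₀ (mul_ne_zero hpi hsq) ?_
    linear_combination h1
  exact_mod_cast h2

end ClassNumber

end

/-- Let `p > 3` be a prime with `p ≡ 3 (mod 4)`, `K = ℚ(√-p)` with class number `h = h(-p)`.
For a positive integer `a` with `gcd(a,p) = 1`, in `𝔽_p` one has
`Tr(θ^{Z_a}) = (-1)^{(h+1)/2} (−2a/p)`. -/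
theorem trace_eq_classNumber_sign_imaginary
    (p : ℕ) [Fact p.Prime] (hp3 : 3 < p) (hp4 : p % 4 = 3)
    (K : Type*) [Field K] [NumberField K]
    (α : K) (hα : α ^ 2 = -(p : K)) (hgen : Algebra.adjoin ℚ {α} = ⊤)
    (h : ℕ) (hh : h = NumberField.classNumber K)
    (F : Type*) [Field F] [Fintype F] [Algebra (ZMod p) F]
    (hcard : Fintype.card F = p ^ p)
    (θ : F) (hθ : θ ^ p = θ + 1)
    (a : ℕ) (ha : 1 ≤ a) (hap : Nat.gcd a p = 1) :
    Algebra.trace (ZMod p) F (θ ^ ZetaRep p a) =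
      (-1) ^ ((h + 1) / 2) * ((legendreSym p (-2 * a) : ℤ) : ZMod p) := by
  rw [trace_pow_zetaRep_eq_factorial p hp4 F hcard hθ ha hap, hh,
    factorial_half_eq_of_mul_eq_neg_sum hp4 (mul_classNumber_eq_neg_sum hα hgen hp4 hp3)]
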